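/- arXiv:1912.03710 — 3 statements merged into one kernel-verified Lean document; each statement's English description precedes it below -/
import Mathlib

section
/- Let R be a regular F-finite Noetherian ring of characteristic p, I₁,…,I_t ideals, J an ideal, and {J_i} a family of ideals with J = ⋂_i J_i and I₁,…,I_t ⊆ √J. Then for every e, V^J(p^e) = ⋃_i V^{J_i}(p^e), where V^{J'}(p^e) = {a ∈ ℕ^t : I₁^{a₁}⋯I_t^{a_t} ⊄ (J')^{[p^e]}}. Consequently B^J(I₁,…,I_t) = ⋃_i B^{J_i}(I₁,…,I_t), and their volumes agree. -/
open Ideal Filter MeasureTheory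

/-- The `q`-th Frobenius power of an ideal: the ideal generated by `q`-th powers of its
elements (used with `q = p ^ e`). -/
def Ideal.frobPow {R : Type*} [CommRing R] (J : Ideal R) (q : ℕ) : Ideal R :=
  Ideal.span ((fun a => a ^ q) '' (J : Set R))

/-- The set `V` of exponent vectors `a ∈ ℕ^t` with `I₁^{a₁} ⋯ I_t^{a_t} ⊄ J'`. -/
def Vnu {R : Type*} [CommRing R] {t : ℕ} (I : Fin t → Ideal R) (J' : Ideal R) :
    Set (Fin t → ℕ) :=
  {a | ¬ (∏ i, I i ^ a i) ≤ J'}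

universe u v

/-- A ring homomorphism `f : R → S` is pure if for every `R`-module `M`, the natural map
`M → M ⊗_R S` (with `S` viewed as an `R`-module via `f`) is injective. -/
def RingHom.IsPureHom {R : Type u} {S : Type v} [CommRing R] [CommRing S]
    (f : R →+* S) : Prop :=
  ∀ (M : Type (max u v)) [AddCommGroup M] [Module R M],
    letI : Module R S := Module.compHom S f
    Function.Injective (fun m : M => (TensorProduct.tmul R m (1 : S) : TensorProduct R M S))

/-- `R` is F-pure if the Frobenius endomorphism is a pure ring homomorphism. -/
def IsFPure (p : ℕ) (R : Type u) [CommRing R] [Fact p.Prime] [CharP R p] : Prop :=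
  RingHom.IsPureHom (frobenius R p)

/-- The region `B^{J'}(I; q) = ⋃_{a ∈ V} ∏ᵢ [0, aᵢ/q] ⊆ ℝ^t`. -/
def Breg {R : Type*} [CommRing R] {t : ℕ} (I : Fin t → Ideal R) (J' : Ideal R) (q : ℕ) :
    Set (Fin t → ℝ) :=
  ⋃ a ∈ Vnu I J', Set.univ.pi fun i => Set.Icc (0 : ℝ) ((a i : ℝ) / (q : ℝ))

/-- A (Noetherian) regular local ring: local, Noetherian, and the maximal ideal is generated
by `dim R` elements. -/
def IsRegLocalRing (A : Type*) [CommRing A] : Prop :=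
  IsNoetherianRing A ∧ ∃ h : IsLocalRing A, ∃ (n : ℕ) (g : Fin n → A),
    ringKrullDim A = (n : WithBot (WithTop ℕ)) ∧
    Ideal.span (Set.range g) = @IsLocalRing.maximalIdeal A _ h

/-- A regular ring: every localization at a prime is regular local. -/
def IsRegRing (A : Type*) [CommRing A] : Prop :=
  ∀ (P : Ideal A) (hP : P.IsPrime), IsRegLocalRing (@Localization.AtPrime A _ P hP)

/-- `R` is F-finite: `R` is a finitely generated module over the image of Frobenius. -/
def IsFFinite (p : ℕ) (R : Type*) [CommRing R] [Fact p.Prime] [CharP R p] : Prop :=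
  ∃ s : Finset R, Submodule.span (↥(frobenius R p).range) (s : Set R) = ⊤

open IsLocalRing RingTheory.Sequence

/-- Coordinatewise description of the extension of an ideal along a free ring extension. -/
lemma Module.Basis.mem_map_algebraMap_iff {A B κ : Type*} [CommRing A] [CommRing B] [Algebra A B]
    (b : Module.Basis κ A B) (I : Ideal A) (x : B) :
    x ∈ I.map (algebraMap A B) ↔ ∀ k, b.repr x k ∈ I := by
  have hmap : x ∈ I.map (algebraMap A B) ↔ x ∈ (I • ⊤ : Submodule A B) := by
    rw [Ideal.smul_top_eq_map, Submodule.restrictScalars_mem]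
  rw [hmap]
  refine ⟨fun hx k ↦ ?_, fun hx ↦ ?_⟩
  · refine Submodule.smul_induction_on (p := fun y ↦ b.repr y k ∈ I) hx
      (fun r hr m _ ↦ by simpa using I.mul_mem_right _ hr)
      fun y z hy hz ↦ by simpa using I.add_mem hy hz
  · rw [← b.linearCombination_repr x, Finsupp.linearCombination_apply]
    exact Submodule.sum_mem _ fun k _ ↦ Submodule.smul_mem_smul (hx k) Submodule.mem_top

lemma Ideal.map_inf_of_free {A B : Type*} [CommRing A] [CommRing B] [Algebra A B]
    [Module.Free A B] (I K : Ideal A) :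
    (I ⊓ K).map (algebraMap A B) = I.map (algebraMap A B) ⊓ K.map (algebraMap A B) := by
  ext x
  simp only [Ideal.mem_inf, (Module.Free.chooseBasis A B).mem_map_algebraMap_iff, forall_and]

/-- A finite module over a Noetherian local ring on which a generating sequence of the maximal
ideal is regular is free. -/
lemma Module.free_of_isWeaklyRegular_of_ofList_eq_maximalIdeal {A : Type u} {M : Type v}
    [CommRing A] [IsLocalRing A] [IsNoetherianRing A] [AddCommGroup M] [Module A M]
    [Module.Finite A M] (rs : List A) (hrs : Ideal.ofList rs = maximalIdeal A)
    (hreg : IsWeaklyRegular M rs) : Module.Free A M := by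
  induction hn : rs.length generalizing A M rs with
  | zero =>
    obtain rfl := List.length_eq_zero_iff.mp hn
    let := ((isField_iff_maximalIdeal_eq (R := A)).mpr (by simpa using hrs.symm)).toField
    exact Module.Free.of_divisionRing A M
  | succ n ih =>
    obtain ⟨r, rs, rfl⟩ := List.exists_cons_of_length_eq_add_one hn
    have hr : r ∈ maximalIdeal A := hrs ▸ Ideal.subset_span (by simp)
    obtain ⟨h1, h2⟩ := (isWeaklyRegular_cons_iff' M r rs).mp hreg
    have : Nontrivial (A ⧸ Ideal.span {r}) := Ideal.Quotient.nontrivial_iff.mpr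
      fun h ↦ (maximalIdeal.isMaximal A).ne_top
        (top_unique (h ▸ (Ideal.span_singleton_le_iff_mem _).mpr hr))
    have : IsLocalRing (A ⧸ Ideal.span {r}) :=
      .of_surjective' (Ideal.Quotient.mk _) Ideal.Quotient.mk_surjective
    have := Module.Finite.of_restrictScalars_finite A (A ⧸ Ideal.span {r}) (QuotSMulTop r M)
    have hmax : Ideal.ofList (rs.map (Ideal.Quotient.mk (Ideal.span {r}))) =
        maximalIdeal (A ⧸ Ideal.span {r}) := by
      rw [← map_maximalIdeal_of_surjective (Ideal.Quotient.mk (Ideal.span {r}))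
        Ideal.Quotient.mk_surjective, ← hrs, Ideal.map_ofList, List.map_cons, Ideal.ofList_cons]
      simp
    have hfree := ih _ hmax h2 (by simpa using hn)
    have := Module.finitePresentation_of_finite A M
    exact (Module.free_quotSMulTop_iff_free A M
      (by rwa [jacobson_eq_maximalIdeal _ bot_ne_top]) h1).mp hfree

/-- Raising the entries of a regular sequence in the maximal ideal to a power keeps it regular. -/
lemma RingTheory.Sequence.IsWeaklyRegular.map_pow {A M : Type*} [CommRing A] [IsLocalRing A]
    [AddCommGroup M] [Module A M] [IsNoetherian A M] (k : ℕ) (hk : k ≠ 0) (rs ss : List A)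
    (hrs : ∀ r ∈ rs ++ ss, r ∈ maximalIdeal A) (h : IsWeaklyRegular M (rs ++ ss)) :
    IsWeaklyRegular M (rs.map (· ^ k) ++ ss) := by
  induction rs generalizing ss with
  | nil => simpa using h
  | cons x rs ih =>
    have h1 : IsWeaklyRegular M ((rs ++ ss) ++ [x]) :=
      isWeaklyRegular_of_perm_of_subset_maximalIdeal h
        (by simpa using (List.perm_append_singleton x (rs ++ ss)).symm) hrs
    rw [isWeaklyRegular_append_iff, isWeaklyRegular_singleton_iff] at h1
    have h2 : IsWeaklyRegular M ((rs ++ ss) ++ [x ^ k]) := by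
      rw [isWeaklyRegular_append_iff, isWeaklyRegular_singleton_iff]
      exact ⟨h1.1, h1.2.pow k⟩
    have hx : x ^ k ∈ maximalIdeal A := Ideal.pow_mem_of_mem _ (hrs x (by simp)) k hk.bot_lt
    have h3 : IsWeaklyRegular M (rs ++ x ^ k :: ss) := by
      refine isWeaklyRegular_of_perm_of_subset_maximalIdeal h2
        ((List.perm_append_singleton _ _).trans List.perm_middle.symm) fun r hr ↦ ?_
      simp only [List.mem_append, List.mem_singleton] at hr
      rcases hr with hr | rfl
      · exact hrs r (by simp only [List.cons_append, List.mem_cons, List.mem_append]; tauto)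
      · exact hx
    have h4 : ∀ r ∈ rs ++ x ^ k :: ss, r ∈ maximalIdeal A := fun r hr ↦ by
      simp only [List.mem_append, List.mem_cons] at hr
      rcases hr with hr | rfl | hr
      · exact hrs r (by simp [hr])
      · exact hx
      · exact hrs r (by simp [hr])
    refine isWeaklyRegular_of_perm_of_subset_maximalIdeal (ih _ h4 h3)
      (by simp [List.perm_middle]) fun r hr ↦ ?_
    simp only [List.mem_append, List.mem_cons, List.mem_map] at hr
    rcases hr with ⟨y, hy, rfl⟩ | rfl | hr
    · exact Ideal.pow_mem_of_mem _ (hrs y (by simp [hy])) k hk.bot_lt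
    · exact hx
    · exact hrs r (by simp [hr])

/-- If a prime principal ideal of a Noetherian local ring is not contained in any minimal prime,
then the ring is a domain. -/
lemma IsLocalRing.isDomain_of_isPrime_span_singleton {A : Type*} [CommRing A] [IsLocalRing A]
    [IsNoetherianRing A] {x : A} (hx : (Ideal.span {x}).IsPrime)
    (hmin : ∀ P ∈ minimalPrimes A, x ∉ P) : IsDomain A := by
  obtain ⟨P, hP, hPx⟩ := Ideal.exists_minimalPrimes_le (J := Ideal.span {x}) (bot_le (a := _))
  have hprime : P.IsPrime := hP.1.1
  have hxm : x ∈ maximalIdeal A :=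
    le_maximalIdeal hx.ne_top (Ideal.mem_span_singleton_self x)
  have hPbot : P = ⊥ := by
    refine Submodule.eq_bot_of_le_smul_of_le_jacobson_bot (Ideal.span {x}) P
      (IsNoetherian.noetherian P) (fun y hy ↦ ?_) ?_
    · obtain ⟨a, rfl⟩ := Ideal.mem_span_singleton'.mp (hPx hy)
      have ha : a ∈ P := (hprime.mem_or_mem hy).resolve_right (hmin P hP)
      rw [mul_comm]
      exact Submodule.smul_mem_smul (Ideal.mem_span_singleton_self x) ha
    · rw [jacobson_eq_maximalIdeal _ bot_ne_top]
      exact (Ideal.span_singleton_le_iff_mem _).mpr hxm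
  subst hPbot
  exact IsDomain.of_bot_isPrime A

/-- In a Noetherian local ring of positive dimension some element of the maximal ideal lies neither
in its square nor in any minimal prime. -/
lemma IsLocalRing.exists_mem_maximalIdeal_notMem_sq {A : Type*} [CommRing A] [IsLocalRing A]
    [IsNoetherianRing A] (hdim : 1 ≤ ringKrullDim A) :
    ∃ x ∈ maximalIdeal A, x ∉ maximalIdeal A ^ 2 ∧ ∀ P ∈ minimalPrimes A, x ∉ P := by
  have hnot : ¬ ringKrullDim A ≤ 0 := fun h ↦ absurd (hdim.trans h) (by decide)
  by_contra! hcon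
  have hsub : (maximalIdeal A : Set A) ⊆
      ⋃ I ∈ insert (maximalIdeal A ^ 2) (minimalPrimes A), (I : Set A) := fun x hx ↦ by
    by_cases h : x ∈ maximalIdeal A ^ 2
    · exact Set.mem_biUnion (Set.mem_insert _ _) h
    · obtain ⟨P, hP, hxP⟩ := hcon x hx h
      exact Set.mem_biUnion (Set.mem_insert_of_mem _ hP) hxP
  obtain ⟨I, hI, hle⟩ := (Ideal.subset_union_prime_finite
    ((minimalPrimes.finite_of_isNoetherianRing A).insert _) (f := id)
    (maximalIdeal A ^ 2) (maximalIdeal A ^ 2) fun P hP h _ ↦ (hP.resolve_left h).1.1).mp hsub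
  rcases hI with rfl | hI
  · refine hnot ?_
    have hbot : maximalIdeal A = ⊥ :=
      Submodule.eq_bot_of_le_smul_of_le_jacobson_bot (maximalIdeal A) _
        (IsNoetherian.noetherian _) (by simpa [pow_two] using hle)
        (maximalIdeal_le_jacobson _)
    exact (ringKrullDim_eq_zero_of_isField (isField_iff_maximalIdeal_eq.mpr hbot)).le
  · refine hnot ?_
    have hIP : I.IsPrime := hI.1.1
    have heq : maximalIdeal A = I := le_antisymm hle (le_maximalIdeal hIP.ne_top)
    rw [← maximalIdeal_height_eq_ringKrullDim, heq]
    simp [Ideal.height_eq_zero_iff.mpr hI]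

/-- If the maximal ideal is generated by `n + 1` elements, then modulo an element outside its
square it is generated by `n` elements. -/
lemma IsLocalRing.exists_span_singleton_sup_eq_maximalIdeal {A : Type*} [CommRing A]
    [IsLocalRing A] {n : ℕ} (g : Fin (n + 1) → A)
    (hg : Ideal.span (Set.range g) = maximalIdeal A) {x : A} (hx : x ∈ maximalIdeal A)
    (hx2 : x ∉ maximalIdeal A ^ 2) :
    ∃ g' : Fin n → A, Ideal.span {x} ⊔ Ideal.span (Set.range g') = maximalIdeal A := by
  have hgm (i) : g i ∈ maximalIdeal A := hg ▸ Ideal.subset_span ⟨i, rfl⟩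
  obtain ⟨c, hc⟩ := Ideal.mem_span_range_iff_exists_fun.mp (hg ▸ hx)
  obtain ⟨i, hi⟩ : ∃ i, IsUnit (c i) := by
    by_contra! hcon
    refine hx2 (hc ▸ Ideal.sum_mem _ fun i _ ↦ ?_)
    rw [pow_two]
    exact Ideal.mul_mem_mul ((mem_maximalIdeal _).mpr (hcon i)) (hgm i)
  refine ⟨fun j ↦ g (i.succAbove j), le_antisymm (sup_le ?_ ?_) ?_⟩
  · exact (Ideal.span_singleton_le_iff_mem _).mpr hx
  · rw [Ideal.span_le]
    rintro _ ⟨j, rfl⟩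
    exact hgm _
  · have hmem (j : Fin n) : g (i.succAbove j) ∈
        Ideal.span {x} ⊔ Ideal.span (Set.range fun j ↦ g (i.succAbove j)) :=
      Ideal.mem_sup_right (Ideal.subset_span ⟨j, rfl⟩)
    rw [← hg, Ideal.span_le]
    rintro _ ⟨k, rfl⟩
    rcases Fin.eq_self_or_eq_succAbove i k with rfl | ⟨j, rfl⟩
    · rw [Fin.sum_univ_succAbove _ k] at hc
      rw [SetLike.mem_coe, ← Ideal.unit_mul_mem_iff_mem _ hi, eq_sub_of_add_eq hc]
      exact Ideal.sub_mem _ (Ideal.mem_sup_left (Ideal.mem_span_singleton_self x))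
        (Ideal.sum_mem _ fun j _ ↦ Ideal.mul_mem_left _ _ (hmem j))
    · exact hmem j

/-- A regular local ring is a domain, and its maximal ideal is generated by a regular sequence. -/
lemma IsLocalRing.isDomain_and_exists_isWeaklyRegular {A : Type u} [CommRing A] [IsLocalRing A]
    [IsNoetherianRing A] (n : ℕ) (g : Fin n → A)
    (hg : Ideal.span (Set.range g) = maximalIdeal A) (hdim : n ≤ ringKrullDim A) :
    IsDomain A ∧ ∃ rs : List A, Ideal.ofList rs = maximalIdeal A ∧ IsWeaklyRegular A rs := by
  induction n generalizing A with
  | zero =>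
    have hbot : maximalIdeal A = ⊥ := by simpa using hg.symm
    let := ((isField_iff_maximalIdeal_eq (R := A)).mpr hbot).toField
    exact ⟨inferInstance, [], by simp [hbot], .nil A A⟩
  | succ n ih =>
    obtain ⟨x, hx, hx2, hmin⟩ := exists_mem_maximalIdeal_notMem_sq (A := A)
      (le_trans (by exact_mod_cast Nat.le_add_left 1 n) hdim)
    obtain ⟨g', hg'⟩ := exists_span_singleton_sup_eq_maximalIdeal g hg hx hx2
    let π := Ideal.Quotient.mk (Ideal.span {x})
    have hπ : Function.Surjective π := Ideal.Quotient.mk_surjective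
    have hxle : Ideal.span {x} ≤ maximalIdeal A := (Ideal.span_singleton_le_iff_mem _).mpr hx
    have : Nontrivial (A ⧸ Ideal.span {x}) := Ideal.Quotient.nontrivial_iff.mpr
      fun h ↦ (maximalIdeal.isMaximal A).ne_top (top_unique (h ▸ hxle))
    have : IsLocalRing (A ⧸ Ideal.span {x}) := .of_surjective' π hπ
    have hmap : (maximalIdeal A).map π = maximalIdeal (A ⧸ Ideal.span {x}) :=
      map_maximalIdeal_of_surjective π hπ
    have hdim' : (n : WithBot ℕ∞) ≤ ringKrullDim (A ⧸ Ideal.span {x}) := by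
      have h := ringKrullDim_le_ringKrullDim_quotient_add_card ({x} : Finset A)
        (by simpa [ringJacobson_eq_maximalIdeal] using hx)
      rw [Finset.coe_singleton, Finset.card_singleton] at h
      have h' := hdim.trans h
      rw [Nat.cast_add] at h'
      exact ENat.WithBot.add_le_add_natCast_right_iff.mp h'
    obtain ⟨hdom, rs, hrs, hreg⟩ := ih (π ∘ g') (by
      rw [← hmap, ← hg', Ideal.map_sup, Ideal.map_span, Ideal.map_span, Set.range_comp]
      simp [π]) hdim'
    have hA : IsDomain A := isDomain_of_isPrime_span_singleton
      ((Ideal.Quotient.isDomain_iff_prime _).mp hdom) hmin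
    have hx0 : x ≠ 0 := fun h ↦ hx2 (h ▸ zero_mem _)
    obtain ⟨rs, rfl⟩ := (List.map_surjective_iff.mpr hπ) rs
    refine ⟨hA, x :: rs, ?_, ?_⟩
    · rw [← Ideal.map_ofList, ← hmap, Ideal.map_eq_iff_sup_ker_eq_of_surjective π hπ,
        Ideal.mk_ker, sup_eq_left.mpr hxle] at hrs
      rw [Ideal.ofList_cons, sup_comm, hrs]
    · rw [← List.singleton_append, isWeaklyRegular_append_iff, isWeaklyRegular_singleton_iff]
      refine ⟨(IsRegular.of_ne_zero hx0).1, ?_⟩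
      have hx' : Ideal.ofList [x] • (⊤ : Submodule A A) = Ideal.span {x} := by simp
      exact ((Submodule.quotEquivOfEq _ _ hx').isWeaklyRegular_congr rs).mpr
        ((isWeaklyRegular_map_algebraMap_iff (A ⧸ Ideal.span {x}) _ rs).mp hreg)

/-- Extension along a finite homomorphism sending a regular sequence of generators of the maximal
ideal to a regular sequence commutes with intersections. -/
lemma Ideal.map_inf_of_finite_of_isWeaklyRegular {A B : Type*} [CommRing A] [IsLocalRing A]
    [IsNoetherianRing A] [CommRing B] (φ : A →+* B) (hφ : φ.Finite) (rs : List A)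
    (hrs : Ideal.ofList rs = maximalIdeal A) (hreg : IsWeaklyRegular B (rs.map φ))
    (I K : Ideal A) : (I ⊓ K).map φ = I.map φ ⊓ K.map φ := by
  algebraize [φ]
  have : Module.Free A B := Module.free_of_isWeaklyRegular_of_ofList_eq_maximalIdeal rs hrs
    ((isWeaklyRegular_map_algebraMap_iff B B rs).mp hreg)
  exact Ideal.map_inf_of_free (A := A) (B := B) I K

/-- The Frobenius of an F-finite regular local ring commutes with intersections of ideals. -/
lemma IsRegLocalRing.map_frobenius_inf {A : Type u} [CommRing A] (p : ℕ) [Fact p.Prime]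
    [CharP A p] (hA : IsRegLocalRing A) (hfin : (frobenius A p).Finite) (I K : Ideal A) :
    (I ⊓ K).map (frobenius A p) = I.map (frobenius A p) ⊓ K.map (frobenius A p) := by
  obtain ⟨_, _, n, g, hdim, hg⟩ := hA
  obtain ⟨-, rs, hrs, hreg⟩ := isDomain_and_exists_isWeaklyRegular n g hg hdim.ge
  refine Ideal.map_inf_of_finite_of_isWeaklyRegular _ hfin rs hrs ?_ I K
  have hmem : ∀ r ∈ rs ++ [], r ∈ maximalIdeal A := fun r hr ↦
    hrs ▸ Ideal.subset_span (by simpa using hr)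
  simpa [frobenius_def, Function.comp_def] using! IsWeaklyRegular.map_pow p
    (Fact.out : p.Prime).ne_zero rs [] hmem (by simpa using hreg)

lemma IsFFinite.exists_sum_pow_mul_eq {R : Type*} [CommRing R] {p : ℕ} [Fact p.Prime]
    [CharP R p] (h : IsFFinite p R) :
    ∃ s : Finset R, ∀ x : R, ∃ c : R → R, ∑ y ∈ s, c y ^ p * y = x := by
  obtain ⟨s, hs⟩ := h
  refine ⟨s, fun x ↦ ?_⟩
  obtain ⟨c, -, hc⟩ := Submodule.mem_span_finset.mp (hs ▸ Submodule.mem_top (x := x))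
  choose d hd using fun y ↦ (c y).2
  refine ⟨d, hc ▸ Finset.sum_congr rfl fun y _ ↦ ?_⟩
  rw [Subring.smul_def, smul_eq_mul, ← hd, frobenius_def]

/-- F-finiteness passes to localizations. -/
lemma IsFFinite.finite_frobenius_of_isLocalization {R A : Type*} [CommRing R] [CommRing A]
    [Algebra R A] {p : ℕ} [Fact p.Prime] [CharP R p] [CharP A p] (h : IsFFinite p R)
    (S : Submonoid R) [IsLocalization S A] : (frobenius A p).Finite := by
  obtain ⟨s, hs⟩ := h.exists_sum_pow_mul_eq
  classical
  let := (frobenius A p).toAlgebra.toModule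
  refine ⟨⟨s.image (algebraMap R A), top_unique fun z _ ↦ ?_⟩⟩
  obtain ⟨a, b, rfl⟩ := IsLocalization.exists_mk'_eq S z
  obtain ⟨c, hc⟩ := hs (a * (b : R) ^ (p - 1))
  have hz : IsLocalization.mk' A a b =
      ∑ y ∈ s, frobenius A p (IsLocalization.mk' A (c y) b) * algebraMap R A y := by
    have hb : IsUnit (algebraMap R A b) := IsLocalization.map_units A b
    have hmk (r : R) : IsLocalization.mk' A r b * algebraMap R A b = algebraMap R A r :=
      IsLocalization.mk'_spec A r b
    refine (hb.pow p).mul_right_cancel ?_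
    rw [Finset.sum_mul]
    calc IsLocalization.mk' A a b * algebraMap R A b ^ p
        = algebraMap R A (a * (b : R) ^ (p - 1)) := by
          rw [← Nat.sub_add_cancel (Fact.out : p.Prime).one_le, pow_succ', ← mul_assoc, hmk]
          simp
      _ = _ := by
          rw [← hc, map_sum]
          refine Finset.sum_congr rfl fun y _ ↦ ?_
          rw [frobenius_def, mul_right_comm, ← mul_pow, hmk, map_mul, map_pow]
  rw [hz]
  exact Submodule.sum_mem _ fun y hy ↦ Submodule.smul_mem _ (IsLocalization.mk' A (c y) b)
    (Submodule.subset_span (Finset.mem_coe.mpr (Finset.mem_image_of_mem _ hy)))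

section Regular

variable {R : Type u} [CommRing R] {p : ℕ} [Fact p.Prime] [CharP R p]

/-- The Frobenius of an F-finite regular ring commutes with binary intersections of ideals. -/
lemma IsRegRing.map_frobenius_inf (hreg : IsRegRing R) (hFF : IsFFinite p R) (I K : Ideal R) :
    (I ⊓ K).map (frobenius R p) = I.map (frobenius R p) ⊓ K.map (frobenius R p) := by
  refine le_antisymm (Ideal.map_inf_le _) (Ideal.le_of_localization_maximal fun P hP ↦ ?_)
  let A := Localization.AtPrime P
  have hA : CharP A p := (CharP.charP_iff_prime_eq_zero Fact.out).mpr (by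
    rw [← map_natCast (algebraMap R A), CharP.cast_eq_zero, map_zero])
  have hcomm (L : Ideal R) : (L.map (frobenius R p)).map (algebraMap R A) =
      (L.map (algebraMap R A)).map (frobenius A p) := by
    rw [Ideal.map_map, Ideal.map_map]
    congr 1
    ext x
    exact RingHom.map_frobenius (algebraMap R A) p x
  have hfin : (frobenius A p).Finite := hFF.finite_frobenius_of_isLocalization P.primeCompl
  calc _ ≤ (I.map (frobenius R p)).map (algebraMap R A) ⊓
        (K.map (frobenius R p)).map (algebraMap R A) := Ideal.map_inf_le _
    _ = _ := by
      rw [hcomm, hcomm, hcomm, IsLocalization.map_inf P.primeCompl A,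
        (hreg P hP.isPrime).map_frobenius_inf p hfin]

lemma IsRegRing.map_iterateFrobenius_inf (hreg : IsRegRing R) (hFF : IsFFinite p R) (e : ℕ)
    (I K : Ideal R) : (I ⊓ K).map (iterateFrobenius R p e) =
      I.map (iterateFrobenius R p e) ⊓ K.map (iterateFrobenius R p e) := by
  induction e with
  | zero => simp [Ideal.map_id]
  | succ e ih =>
    simp only [add_comm e 1, iterateFrobenius_add R p 1 e, ← Ideal.map_map, ih,
      iterateFrobenius_one, hreg.map_frobenius_inf hFF]

/-- Frobenius powers commute with finite intersections in an F-finite regular ring. -/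
lemma IsRegRing.frobPow_iInf (hreg : IsRegRing R) (hFF : IsFFinite p R) (e : ℕ) {ι : Type*}
    [Finite ι] (J : ι → Ideal R) :
    (⨅ i, J i).frobPow (p ^ e) = ⨅ i, (J i).frobPow (p ^ e) := by
  have := Fintype.ofFinite ι
  let f : InfTopHom (Ideal R) (Ideal R) :=
    { toFun := Ideal.map (iterateFrobenius R p e)
      map_inf' := hreg.map_iterateFrobenius_inf hFF e
      map_top' := Ideal.map_top _ }
  change f (⨅ i, J i) = ⨅ i, f (J i)
  rw [← Finset.inf_univ_eq_iInf, ← Finset.inf_univ_eq_iInf, map_finset_inf]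
  rfl

end Regular

lemma Vnu_iInf {R ι : Type*} [CommRing R] {t : ℕ} (I : Fin t → Ideal R) (J : ι → Ideal R) :
    Vnu I (⨅ i, J i) = ⋃ i, Vnu I (J i) := by
  ext a
  simp [Vnu]

lemma Breg_iInf {R ι : Type*} [CommRing R] {t : ℕ} (I : Fin t → Ideal R) (J : ι → Ideal R)
    (q : ℕ) : Breg I (⨅ i, J i) q = ⋃ i, Breg I (J i) q := by
  simp only [Breg, Vnu_iInf, Set.biUnion_iUnion]

/-- For a regular F-finite ring and `J = ⋂ᵢ Jᵢ`: `V^J(p^e) = ⋃ᵢ V^{Jᵢ}(p^e)` for all `e`;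
consequently `B^J(I) = ⋃ᵢ B^{Jᵢ}(I)` and their volumes agree. -/
theorem stmt12 {R : Type u} [CommRing R] [IsNoetherianRing R] (p : ℕ) [Fact p.Prime]
    [CharP R p] (hreg : IsRegRing R) (hFF : IsFFinite p R) {t : ℕ}
    (I : Fin t → Ideal R) {ι : Type} [Fintype ι] (Jfam : ι → Ideal R) (J : Ideal R)
    (hJ : J = ⨅ i, Jfam i) (hrad : ∀ i, I i ≤ J.radical) :
    (∀ e : ℕ, Vnu I (J.frobPow (p ^ e)) = ⋃ i, Vnu I ((Jfam i).frobPow (p ^ e))) ∧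
    (⋃ e : ℕ, Breg I (J.frobPow (p ^ e)) (p ^ e)) =
      (⋃ i, ⋃ e : ℕ, Breg I ((Jfam i).frobPow (p ^ e)) (p ^ e)) ∧
    MeasureTheory.volume (⋃ e : ℕ, Breg I (J.frobPow (p ^ e)) (p ^ e)) =
      MeasureTheory.volume (⋃ i, ⋃ e : ℕ, Breg I ((Jfam i).frobPow (p ^ e)) (p ^ e)) := by
  have hV (e : ℕ) : J.frobPow (p ^ e) = ⨅ i, (Jfam i).frobPow (p ^ e) :=
    hJ ▸ hreg.frobPow_iInf hFF e Jfam
  have hB : (⋃ e : ℕ, Breg I (J.frobPow (p ^ e)) (p ^ e)) =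
      ⋃ i, ⋃ e : ℕ, Breg I ((Jfam i).frobPow (p ^ e)) (p ^ e) := by
    simp only [hV, Breg_iInf]
    exact Set.iUnion_comm _
  exact ⟨fun e ↦ by rw [hV, Vnu_iInf], hB, by rw [hB]⟩
end

section
/- Let (R, 𝔪, K) be a regular local ring of characteristic p, I ⊆ 𝔪 an ideal minimally generated by f₁,…,f_t. Then Vol_F^𝔪(f₁,…,f_t) = 1 if and only if f₁,…,f_t is a regular sequence and R/I is F-pure (i.e., I is an F-pure complete intersection). -/
open Ideal Filter MeasureTheory

universe u v

section RegularSystem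
open IsLocalRing RingTheory.Sequence

lemma ringKrullDim_le_ringKrullDim_quotient_ofList_add_length {R : Type*} [CommRing R]
    [IsNoetherianRing R] [IsLocalRing R] (l : List R) (h : ofList l ≤ maximalIdeal R) :
    ringKrullDim R ≤ ringKrullDim (R ⧸ ofList l) + l.length := by
  classical
  refine (ringKrullDim_le_ringKrullDim_quotient_add_spanFinrank (ofList l)
    (h.trans (by rw [ringJacobson_eq_maximalIdeal]))).trans ?_
  gcongr
  have h2 := Submodule.spanFinrank_span_le_ncard_of_finite (R := R) (s := {r | r ∈ l})
    l.finite_toSet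
  refine h2.trans ?_
  have : {r | r ∈ l} = (l.toFinset : Set R) := by ext; simp
  rw [this, Set.ncard_coe_finset]
  exact l.toFinset_card_le

lemma ringKrullDim_le_length_of_ofList_eq_maximalIdeal {R : Type*} [CommRing R]
    [IsNoetherianRing R] [IsLocalRing R] (l : List R) (h : ofList l = maximalIdeal R) :
    ringKrullDim R ≤ l.length := by
  have h1 := ringKrullDim_le_ringKrullDim_quotient_ofList_add_length l h.le
  rwa [h, ringKrullDim_eq_zero_of_isField ((Quotient.maximal_ideal_iff_isField_quotient _).1
    (maximalIdeal.isMaximal R)), zero_add] at h1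

lemma map_quotientMk_maximalIdeal {R : Type*} [CommRing R] [IsLocalRing R] (J : Ideal R)
    [IsLocalRing (R ⧸ J)] :
    (maximalIdeal R).map (Ideal.Quotient.mk J) = maximalIdeal (R ⧸ J) := by
  have := IsLocalHom.of_surjective (Ideal.Quotient.mk J) Ideal.Quotient.mk_surjective
  have h := maximalIdeal_comap (Ideal.Quotient.mk J)
  rw [← h, map_comap_of_surjective _ Ideal.Quotient.mk_surjective]

lemma exists_ofList_cons_eq_of_mem_of_notMem_mul {R : Type*} [CommRing R] [IsLocalRing R]
    (l : List R) (x : R) (hx : x ∈ ofList l) (hx' : x ∉ maximalIdeal R * ofList l) :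
    ∃ l' : List R, l'.length + 1 = l.length ∧ ofList (x :: l') = ofList l := by
  induction l generalizing x with
  | nil => simp_all
  | cons b l ih =>
    rw [ofList_cons, Submodule.mem_sup] at hx
    obtain ⟨y, hy, z, hz, rfl⟩ := hx
    obtain ⟨c, rfl⟩ := mem_span_singleton'.1 hy
    by_cases hc : IsUnit c
    · refine ⟨l, rfl, ?_⟩
      rw [ofList_cons, ofList_cons]
      obtain ⟨c', hc'⟩ := hc.exists_left_inv
      refine le_antisymm (sup_le ?_ le_sup_right) (sup_le ?_ le_sup_right)
      · rw [span_singleton_le_iff_mem]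
        exact add_mem (mem_sup_left hy) (mem_sup_right hz)
      · rw [span_singleton_le_iff_mem]
        have : b = c' * (c * b + z) + (- c') * z := by linear_combination (-b) * hc'
        exact Submodule.mem_sup.2 ⟨_, mul_mem_left _ c' (mem_span_singleton_self _), _,
          mul_mem_left _ (-c') hz, this.symm⟩
    · have hcm : c ∈ maximalIdeal R := hc
      have hcb : c * b ∈ maximalIdeal R * ofList (b :: l) :=
        mul_mem_mul hcm (by rw [ofList_cons]; exact mem_sup_left (mem_span_singleton_self b))
      obtain ⟨l', hl', h⟩ := ih z hz fun h ↦ hx' (add_mem hcb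
        (mul_mono_right (by rw [ofList_cons]; exact le_sup_right) h))
      refine ⟨b :: l', by simp [hl'], ?_⟩
      rw [ofList_cons b l, ← h]
      simp only [ofList_cons]
      have e : span {z} ⊔ span {b} = span {c * b + z} ⊔ span {b} := by
        refine le_antisymm (sup_le ?_ le_sup_right) (sup_le ?_ le_sup_right) <;>
          rw [span_singleton_le_iff_mem]
        · have : z = (c * b + z) + (- c) * b := by ring
          exact (Submodule.mem_sup.2 ⟨_, mem_span_singleton_self _, _,
            mul_mem_left _ (-c) (mem_span_singleton_self b), this.symm⟩)
        · exact add_mem (mem_sup_right hy) (mem_sup_left (mem_span_singleton_self _))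
      rw [← sup_assoc, ← sup_assoc, ← e, sup_comm (span {z})]

lemma isDomain_of_ofList_eq_maximalIdeal (n : ℕ) : ∀ {R : Type u} [CommRing R]
    [IsNoetherianRing R] [IsLocalRing R] (l : List R), l.length = n →
    ofList l = maximalIdeal R → (n : WithBot ℕ∞) ≤ ringKrullDim R → IsDomain R := by
  induction n with
  | zero =>
    intro R _ _ _ l hl hlm _
    obtain rfl := List.length_eq_zero_iff.1 hl
    rw [ofList_nil] at hlm
    exact ((isField_iff_maximalIdeal_eq (R := R)).2 hlm.symm).isDomain
  | succ n ih =>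
    intro R _ _ _ l hl hlm hdim
    have hheight : (maximalIdeal R).height ≠ 0 := by
      intro h
      rw [← maximalIdeal_height_eq_ringKrullDim, h] at hdim
      norm_cast at hdim
    have hmin : maximalIdeal R ∉ minimalPrimes R := fun h ↦ hheight (height_eq_zero_iff.2 h)
    have hfin := minimalPrimes.finite_of_isNoetherianRing R
    have hsq : ¬ maximalIdeal R ≤ maximalIdeal R * maximalIdeal R := by
      intro h
      have h0 : maximalIdeal R = ⊥ :=
        Submodule.eq_bot_of_le_smul_of_le_jacobson_bot _ _ (IsNoetherian.noetherian _) h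
          (maximalIdeal_le_jacobson _)
      have : IsDomain R := ((isField_iff_maximalIdeal_eq (R := R)).2 h0).isDomain
      exact hheight (by rw [h0]; simp)
    obtain ⟨x, hxm, hx⟩ : ∃ x ∈ maximalIdeal R,
        x ∉ maximalIdeal R * maximalIdeal R ∧ ∀ P ∈ minimalPrimes R, x ∉ P := by
      by_contra! hcon
      have hsub := (subset_union_prime' (s := hfin.toFinset) (f := fun i ↦ i)
        (a := maximalIdeal R * maximalIdeal R) (b := maximalIdeal R * maximalIdeal R)
        (I := maximalIdeal R) (by
          intro i hi
          exact (hfin.mem_toFinset.1 hi).isPrime)).1 (by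
          intro y hy
          by_cases hy2 : y ∈ maximalIdeal R * maximalIdeal R
          · exact Or.inl (Or.inl hy2)
          · obtain ⟨P, hP, hyP⟩ := hcon y hy hy2
            refine Or.inr ?_
            simp only [Set.mem_iUnion]
            exact ⟨P, by simpa using hP, hyP⟩)
      rcases hsub with h | h | ⟨P, hP, h⟩
      · exact hsq h
      · exact hsq h
      · have hP' := hfin.mem_toFinset.1 hP
        have := hP'.isPrime
        have e : maximalIdeal R = P := le_antisymm h (le_maximalIdeal this.ne_top)
        exact hmin (e ▸ hP')
    obtain ⟨hx2, hxP⟩ := hx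
    obtain ⟨l', hl', hxl⟩ := exists_ofList_cons_eq_of_mem_of_notMem_mul l x (hlm ▸ hxm)
      (by rwa [hlm])
    have hx1 : ofList [x] ≤ maximalIdeal R := by
      rw [ofList_singleton, span_singleton_le_iff_mem]; exact hxm
    have hnt : Nontrivial (R ⧸ ofList [x]) :=
      Ideal.Quotient.nontrivial_iff.2 (fun h ↦ (maximalIdeal.isMaximal R).ne_top
        (top_le_iff.1 (h ▸ hx1)))
    have hloc : IsLocalRing (R ⧸ ofList [x]) :=
      IsLocalRing.of_surjective' (Ideal.Quotient.mk _) Ideal.Quotient.mk_surjective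
    have hd := ringKrullDim_le_ringKrullDim_quotient_ofList_add_length [x] hx1
    have hdom : IsDomain (R ⧸ ofList [x]) := by
      refine ih (l'.map (Ideal.Quotient.mk _)) (by simp; omega) ?_ ?_
      · rw [← map_quotientMk_maximalIdeal, ← hlm, ← hxl, map_ofList, List.map_cons]
        have : Ideal.Quotient.mk (ofList [x]) x = 0 :=
          Ideal.Quotient.eq_zero_iff_mem.2 (by
            rw [ofList_singleton]; exact mem_span_singleton_self x)
        rw [this, ofList_cons]; simp
      · have h3 := hdim.trans hd
        simp only [List.length_singleton, Nat.cast_add, Nat.cast_one] at h3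
        exact ENat.WithBot.add_le_add_one_right_iff.1 h3
    rw [ofList_singleton] at hdom
    have hprime : (span {x}).IsPrime := (Ideal.Quotient.isDomain_iff_prime _).1 hdom
    obtain ⟨P, hP, hPx⟩ := exists_minimalPrimes_le (I := (⊥ : Ideal R)) (J := span {x}) bot_le
    have hPp : P.IsPrime := hP.isPrime
    have hP0 : P = ⊥ := by
      refine Submodule.eq_bot_of_le_smul_of_le_jacobson_bot (maximalIdeal R) _
        (IsNoetherian.noetherian _) ?_ (maximalIdeal_le_jacobson _)
      intro y hy
      obtain ⟨r, rfl⟩ := mem_span_singleton'.1 (hPx hy)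
      have hr := (hPp.mem_or_mem hy).resolve_right (hxP P hP)
      rw [mul_comm]
      exact mul_mem_mul hxm hr
    rw [hP0] at hPp
    exact IsDomain.of_bot_isPrime R

lemma isSMulRegular_quotient_ofList_iff {R : Type*} [CommRing R] (l : List R) (r : R) :
    IsSMulRegular (R ⧸ (ofList l • ⊤ : Submodule R R)) r ↔
      ∀ a, r * a ∈ ofList l → a ∈ ofList l := by
  rw [isSMulRegular_quotient_iff_mem_of_smul_mem]
  simp

lemma isWeaklyRegular_of_ofList_eq_maximalIdeal {R : Type u} [CommRing R]
    [IsNoetherianRing R] [IsLocalRing R] (l : List R)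
    (hlm : ofList l = maximalIdeal R) (hdim : (l.length : WithBot ℕ∞) ≤ ringKrullDim R) :
    IsWeaklyRegular R l := by
  refine ⟨fun i hi ↦ (isSMulRegular_quotient_ofList_iff _ _).2 ?_⟩
  have hprime : (ofList (l.take i)).IsPrime := by
    have hle : ofList (l.take i) ≤ maximalIdeal R := by
      rw [← hlm]
      exact span_mono fun x hx ↦ List.mem_of_mem_take hx
    have hnt : Nontrivial (R ⧸ ofList (l.take i)) :=
      Ideal.Quotient.nontrivial_iff.2 (fun h ↦ (maximalIdeal.isMaximal R).ne_top
        (top_le_iff.1 (h ▸ hle)))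
    have hloc : IsLocalRing (R ⧸ ofList (l.take i)) :=
      IsLocalRing.of_surjective' (Ideal.Quotient.mk _) Ideal.Quotient.mk_surjective
    have hd := hdim.trans (ringKrullDim_le_ringKrullDim_quotient_ofList_add_length _ hle)
    have hd' : ((l.length - i : ℕ) : WithBot ℕ∞) ≤ ringKrullDim (R ⧸ ofList (l.take i)) := by
      have e : l.length = (l.length - i) + i := by omega
      rw [List.length_take, min_eq_left hi.le, e, Nat.cast_add] at hd
      exact ENat.WithBot.add_le_add_natCast_right_iff.1 (by simpa using hd)
    refine (Ideal.Quotient.isDomain_iff_prime _).1 ?_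
    refine isDomain_of_ofList_eq_maximalIdeal (l.length - i)
      ((l.drop i).map (Ideal.Quotient.mk _)) (by simp) ?_ hd'
    rw [← map_quotientMk_maximalIdeal, ← hlm]
    have e : ofList l = ofList (l.take i) ⊔ ofList (l.drop i) := by
      rw [← ofList_append, List.take_append_drop]
    rw [e, Ideal.map_sup, map_quotient_self, bot_sup_eq, map_ofList]
  intro a ha
  refine (hprime.mem_or_mem ha).resolve_left fun hmem ↦ ?_
  have e : ofList (l.take i ++ l.drop (i + 1)) = maximalIdeal R := by
    conv_rhs => rw [← hlm, ← List.take_append_drop i l, List.drop_eq_getElem_cons hi]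
    rw [ofList_append, ofList_append, ofList_cons, ← sup_assoc,
      sup_eq_left.2 ((span_singleton_le_iff_mem _).2 hmem)]
  have hd := hdim.trans (ringKrullDim_le_length_of_ofList_eq_maximalIdeal _ e)
  rw [Nat.cast_le] at hd
  simp at hd
  omega

end RegularSystem

section LocalCriterion
open IsLocalRing RingTheory.Sequence TensorProduct

lemma eq_zero_of_mem_span_tmul_of_isWeaklyRegular {R N : Type*} [CommRing R] [AddCommGroup N]
    [Module R N] (J : Ideal R) (rs : List R) (hreg : IsWeaklyRegular N rs) (hJ : ∀ r ∈ rs, r ∈ J)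
    (z : J ⊗[R] N)
    (hz : z ∈ Submodule.span R {y : J ⊗[R] N | ∃ r : J, (r : R) ∈ rs ∧ ∃ n : N, r ⊗ₜ n = y})
    (hz0 : TensorProduct.lid R N (J.subtype.rTensor N z) = 0) : z = 0 := by
  induction rs using List.reverseRecOn generalizing z with
  | nil => simpa using hz
  | append_singleton rs r ih =>
    have hrJ : r ∈ J := hJ r (by simp)
    set P : Submodule R (J ⊗[R] N) :=
      Submodule.span R {y : J ⊗[R] N | ∃ r : J, (r : R) ∈ rs ∧ ∃ n : N, r ⊗ₜ n = y} with hP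
    obtain ⟨h1, h2⟩ := (isWeaklyRegular_append_iff N rs [r]).1 hreg
    rw [isWeaklyRegular_singleton_iff, isSMulRegular_quotient_iff_mem_of_smul_mem] at h2
    have hμ : P ≤ Submodule.comap
        ((TensorProduct.lid R N).toLinearMap ∘ₗ J.subtype.rTensor N)
        (ofList rs • ⊤ : Submodule R N) := by
      refine Submodule.span_le.2 ?_
      rintro _ ⟨s, hs, n, rfl⟩
      simpa using Submodule.smul_mem_smul (Ideal.subset_span (s := {r | r ∈ rs}) hs)
        (Submodule.mem_top (x := n))
    have hdec : ∃ z' ∈ P, ∃ n : N, z = z' + (⟨r, hrJ⟩ : J) ⊗ₜ n := by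
      refine Submodule.span_induction ?_ ?_ ?_ ?_ hz
      · rintro _ ⟨s, hs, n, rfl⟩
        rcases List.mem_append.1 hs with hs | hs
        · exact ⟨_, Submodule.subset_span ⟨s, hs, n, rfl⟩, 0, by simp⟩
        · refine ⟨0, zero_mem _, n, ?_⟩
          have : s = ⟨r, hrJ⟩ := Subtype.ext (by simpa using hs)
          rw [this, zero_add]
      · exact ⟨0, zero_mem _, 0, by simp⟩
      · rintro _ _ - - ⟨z₁, hz₁, n₁, rfl⟩ ⟨z₂, hz₂, n₂, rfl⟩
        exact ⟨_, add_mem hz₁ hz₂, n₁ + n₂, by rw [tmul_add]; abel⟩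
      · rintro c _ - ⟨z₁, hz₁, n₁, rfl⟩
        exact ⟨_, P.smul_mem c hz₁, c • n₁, by rw [smul_add, tmul_smul]⟩
    obtain ⟨z', hz', n, rfl⟩ := hdec
    have hn : n ∈ (ofList rs • ⊤ : Submodule R N) := by
      refine h2 n ?_
      have h3 := hμ hz'
      simp only [map_add, LinearMap.rTensor_tmul, lid_tmul, Submodule.subtype_apply] at hz0
      rw [← neg_eq_iff_add_eq_zero] at hz0
      rw [← hz0]
      exact neg_mem h3
    refine ih h1 (fun s hs ↦ hJ s (by simp [hs])) _ ?_ hz0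
    refine add_mem hz' ?_
    refine Submodule.smul_induction_on hn ?_ ?_
    · intro c hc n' _
      have : ofList rs ≤ Submodule.comap
          ((TensorProduct.mk R J N ⟨r, hrJ⟩) ∘ₗ LinearMap.toSpanSingleton R N n') P := by
        refine span_le.2 ?_
        intro s hs
        have hsJ : s ∈ J := hJ s (List.mem_append_left _ hs)
        refine Submodule.subset_span ⟨⟨s, hsJ⟩, hs, r • n', ?_⟩
        simp only [LinearMap.coe_comp, Function.comp_apply, LinearMap.toSpanSingleton_apply, mk_apply]
        rw [← smul_tmul, ← smul_tmul]
        congr 1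
        exact Subtype.ext (mul_comm _ _)
      exact this hc
    · intro x y hx hy
      rw [tmul_add]
      exact add_mem hx hy

lemma rTensor_subtype_ofList_injective_of_isWeaklyRegular {R N : Type*} [CommRing R]
    [AddCommGroup N] [Module R N] (rs : List R) (hreg : IsWeaklyRegular N rs) :
    Function.Injective ((ofList rs).subtype.rTensor N) := by
  refine (injective_iff_map_eq_zero _).2 fun z hz ↦ ?_
  refine eq_zero_of_mem_span_tmul_of_isWeaklyRegular _ rs hreg (fun r hr ↦ subset_span hr) z ?_
    ((congrArg _ hz).trans (map_zero _))
  clear hz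
  induction z using TensorProduct.induction_on with
  | zero => exact zero_mem _
  | add x y hx hy => exact add_mem hx hy
  | tmul x n =>
    obtain ⟨x, hx⟩ := x
    refine Submodule.span_induction (p := fun x hx ↦ (⟨x, hx⟩ : ofList rs) ⊗ₜ[R] n ∈
      Submodule.span R {y : ofList rs ⊗[R] N | ∃ r : ofList rs, (r : R) ∈ rs ∧
        ∃ n : N, r ⊗ₜ n = y}) ?_ ?_ ?_ ?_ hx
    · intro r hr
      exact Submodule.subset_span ⟨⟨r, subset_span hr⟩, hr, n, rfl⟩
    · have : (⟨0, zero_mem _⟩ : ofList rs) ⊗ₜ[R] n = 0 := zero_tmul _ _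
      rw [this]
      exact zero_mem _
    · intro a b ha hb h1 h2
      have := add_mem h1 h2
      rwa [← add_tmul] at this
    · intro c a ha h1
      exact Submodule.smul_mem _ c h1

lemma rTensor_inclusion_injective_of_maximalIdeal_smul {R N : Type*} [CommRing R]
    [IsLocalRing R] [AddCommGroup N] [Module R N]
    (hk : Function.Injective ((maximalIdeal R).subtype.rTensor N)) (K L : Ideal R) (x : R)
    (hx : x ∉ K) (hmx : ∀ r ∈ maximalIdeal R, r * x ∈ K) (hL : L = K ⊔ span {x})
    (hKL : K ≤ L) :
    Function.Injective ((Submodule.inclusion hKL).rTensor N) := by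
  have hxL : x ∈ L := hL ▸ mem_sup_right (mem_span_singleton_self x)
  let i : maximalIdeal R →ₗ[R] K × R := LinearMap.prod
    (-(LinearMap.codRestrict K ((LinearMap.toSpanSingleton R R x) ∘ₗ (maximalIdeal R).subtype)
      fun r ↦ hmx r r.2)) (maximalIdeal R).subtype
  let π : K × R →ₗ[R] L := LinearMap.coprod (Submodule.inclusion hKL)
    (LinearMap.toSpanSingleton R L ⟨x, hxL⟩)
  have hexact : Function.Exact i π := by
    rintro ⟨k, r⟩
    constructor
    · intro h
      have h' : (k : R) + r * x = 0 := congrArg Subtype.val h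
      have hr : r ∈ maximalIdeal R := by
        intro hu
        refine hx ((K.unit_mul_mem_iff_mem hu).1 ?_)
        rw [← neg_eq_of_add_eq_zero_right h']
        exact neg_mem k.2
      refine ⟨⟨r, hr⟩, Prod.ext (Subtype.ext ?_) rfl⟩
      change -(r * x) = k
      linear_combination -h'
    · rintro ⟨r, h⟩
      rw [← h]
      refine Subtype.ext ?_
      change -((r : R) * x) + (r : R) * x = 0
      ring
  have hsurj : Function.Surjective π := by
    rintro ⟨y, hy⟩
    rw [hL] at hy
    obtain ⟨k, hk, w, hw, rfl⟩ := Submodule.mem_sup.1 hy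
    obtain ⟨r, rfl⟩ := mem_span_singleton'.1 hw
    exact ⟨(⟨k, hk⟩, r), rfl⟩
  refine (injective_iff_map_eq_zero _).2 fun z hz ↦ ?_
  have h0 : π.rTensor N ((LinearMap.inl R K R).rTensor N z) = 0 := by
    rw [← LinearMap.rTensor_comp_apply, LinearMap.coprod_inl, hz]
  obtain ⟨y, hy⟩ := (rTensor_exact N hexact hsurj _).1 h0
  have h1 := congrArg ((LinearMap.snd R K R).rTensor N) hy
  rw [← LinearMap.rTensor_comp_apply, ← LinearMap.rTensor_comp_apply, LinearMap.snd_comp_inl,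
    LinearMap.snd_prod, LinearMap.rTensor_zero, LinearMap.zero_apply] at h1
  have hy0 : y = 0 := hk (by rw [h1, map_zero])
  have h2 := congrArg ((LinearMap.fst R K R).rTensor N) hy
  rw [hy0, map_zero, map_zero, ← LinearMap.rTensor_comp_apply, LinearMap.fst_comp_inl,
    LinearMap.rTensor_id] at h2
  exact h2.symm

lemma rTensor_subtype_injective_of_pow_maximalIdeal_le {R N : Type*} [CommRing R]
    [IsNoetherianRing R] [IsLocalRing R] [AddCommGroup N] [Module R N]
    (hk : Function.Injective ((maximalIdeal R).subtype.rTensor N)) (n : ℕ) (K : Ideal R)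
    (hK : maximalIdeal R ^ n ≤ K) : Function.Injective (K.subtype.rTensor N) := by
  induction K using IsNoetherian.induction with
  | hgt K ih =>
    by_cases htop : K = ⊤
    · subst htop
      have : Submodule.subtype (⊤ : Ideal R) = (Submodule.topEquiv (R := R) (M := R)).toLinearMap :=
        rfl
      rw [this]
      exact (LinearEquiv.rTensor N (Submodule.topEquiv (R := R) (M := R))).injective
    have hex : ∃ j, maximalIdeal R ^ j ≤ K := ⟨n, hK⟩
    classical
    obtain ⟨j, hj⟩ : ∃ j, Nat.find hex = j + 1 := by
      refine Nat.exists_eq_succ_of_ne_zero fun h0 ↦ htop ?_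
      have := Nat.find_spec hex
      rw [h0, pow_zero, one_eq_top] at this
      exact top_le_iff.1 this
    have hj1 : maximalIdeal R ^ (j + 1) ≤ K := hj ▸ Nat.find_spec hex
    obtain ⟨x, hxj, hx⟩ := SetLike.not_le_iff_exists.1 (Nat.find_min hex (m := j) (by omega))
    have hKL : K ≤ K ⊔ span {x} := le_sup_left
    have h1 := rTensor_inclusion_injective_of_maximalIdeal_smul hk K (K ⊔ span {x}) x hx
      (fun r hr ↦ hj1 (by rw [pow_succ']; exact mul_mem_mul hr hxj)) rfl hKL
    have h2 := ih (K ⊔ span {x}) (lt_of_le_of_ne hKL fun h ↦ hx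
      (h ▸ mem_sup_right (mem_span_singleton_self x))) (hK.trans hKL)
    have e : K.subtype = (K ⊔ span {x}).subtype ∘ₗ Submodule.inclusion hKL := rfl
    rw [e, LinearMap.rTensor_comp]
    exact h2.comp h1

/-- The local criterion of flatness, for a local homomorphism of noetherian local rings. -/
theorem Module.Flat.of_rTensor_maximalIdeal_injective {R R' : Type*} [CommRing R] [CommRing R']
    [IsNoetherianRing R] [IsLocalRing R] [IsNoetherianRing R'] [IsLocalRing R'] [Algebra R R']
    [IsLocalHom (algebraMap R R')]
    (hk : Function.Injective ((maximalIdeal R).subtype.rTensor R')) : Module.Flat R R' := by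
  refine Module.Flat.iff_rTensor_injective'.2 fun J ↦ (injective_iff_map_eq_zero _).2 fun z hz ↦ ?_
  have hmem (n : ℕ) : z ∈ LinearMap.range
      ((Submodule.inclusion (inf_le_left : J ⊓ maximalIdeal R ^ n ≤ J)).rTensor R') := by
    set K := J ⊔ maximalIdeal R ^ n
    have hJK : J ≤ K := le_sup_left
    have hK := rTensor_subtype_injective_of_pow_maximalIdeal_le hk n K le_sup_right
    have hzK : (Submodule.inclusion hJK).rTensor R' z = 0 := by
      refine hK ?_
      rw [map_zero, ← LinearMap.rTensor_comp_apply]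
      exact hz
    let Q : Submodule R K := Submodule.comap K.subtype (maximalIdeal R ^ n)
    let g : J →ₗ[R] K ⧸ Q := Q.mkQ ∘ₗ Submodule.inclusion hJK
    have hexact : Function.Exact
        (Submodule.inclusion (inf_le_left : J ⊓ maximalIdeal R ^ n ≤ J)) g := by
      rintro ⟨y, hy⟩
      have : g ⟨y, hy⟩ = 0 ↔ y ∈ maximalIdeal R ^ n := by
        simp only [g, LinearMap.comp_apply, Submodule.mkQ_apply, Submodule.Quotient.mk_eq_zero]
        rfl
      rw [this]
      constructor
      · intro h
        exact ⟨⟨y, hy, h⟩, rfl⟩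
      · rintro ⟨w, hw⟩
        have : (w : R) = y := congrArg Subtype.val hw
        exact this ▸ w.2.2
    have hsurj : Function.Surjective g := by
      intro q
      obtain ⟨⟨k, hk⟩, rfl⟩ := Q.mkQ_surjective q
      obtain ⟨a, ha, b, hb, rfl⟩ := Submodule.mem_sup.1 hk
      refine ⟨⟨a, ha⟩, (Submodule.Quotient.eq Q).2 ?_⟩
      change a - (a + b) ∈ maximalIdeal R ^ n
      rw [sub_add_cancel_left]
      exact neg_mem hb
    refine (_root_.rTensor_exact R' hexact hsurj z).1 ?_
    rw [LinearMap.rTensor_comp_apply, hzK, map_zero]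
  obtain ⟨k, hAR⟩ := (maximalIdeal R).exists_pow_inf_eq_pow_smul J
  set 𝔫 := (maximalIdeal R).map (algebraMap R R')
  have hn : 𝔫 ≠ ⊤ := fun h ↦ (maximalIdeal.isMaximal R').ne_top
    (top_le_iff.1 (h ▸ map_le_iff_le_comap.2 (maximalIdeal_comap (algebraMap R R')).ge))
  have hpow (n : ℕ) : TensorProduct.comm R J R' z ∈ (𝔫 ^ n • ⊤ : Submodule R' (R' ⊗[R] J)) := by
    obtain ⟨w, rfl⟩ := hmem (n + k)
    clear hz hmem
    induction w using TensorProduct.induction_on with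
    | zero => simp
    | add x y hx hy => rw [map_add, map_add]; exact add_mem hx hy
    | tmul y s =>
      obtain ⟨y, hy⟩ := y
      have hy' : y ∈ maximalIdeal R ^ n • (maximalIdeal R ^ k • ⊤ ⊓ J) := by
        have := hAR (n + k) (by omega)
        rw [Nat.add_sub_cancel] at this
        rw [← this]
        exact ⟨by simpa using hy.2, hy.1⟩
      have hs : ∃ h : y ∈ J, s ⊗ₜ[R] (⟨y, h⟩ : J) ∈ (𝔫 ^ n • ⊤ : Submodule R' (R' ⊗[R] J)) := by
        refine Submodule.smul_induction_on hy' ?_ ?_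
        · intro a ha b hb
          refine ⟨J.mul_mem_left a hb.2, ?_⟩
          have e : s ⊗ₜ[R] (⟨a • b, J.mul_mem_left a hb.2⟩ : J) =
              algebraMap R R' a • (s ⊗ₜ[R] (⟨b, hb.2⟩ : J)) := by
            rw [algebraMap_smul]
            exact tmul_smul a s (⟨b, hb.2⟩ : J)
          rw [e]
          refine Submodule.smul_mem_smul ?_ Submodule.mem_top
          rw [← Ideal.map_pow]
          exact mem_map_of_mem _ ha
        · rintro a b ⟨ha, ha'⟩ ⟨hb, hb'⟩
          have := add_mem ha' hb'
          rw [← tmul_add] at this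
          exact ⟨add_mem ha hb, this⟩
      exact hs.2
  have h0 : TensorProduct.comm R J R' z ∈ (⨅ n : ℕ, 𝔫 ^ n • ⊤ : Submodule R' (R' ⊗[R] J)) :=
    (Submodule.mem_iInf _).2 hpow
  rw [𝔫.iInf_pow_smul_eq_bot_of_isLocalRing hn, Submodule.mem_bot] at h0
  exact (TensorProduct.comm R J R').injective (h0.trans (map_zero _).symm)

end LocalCriterion

section Purity
open IsLocalRing TensorProduct

lemma tmul_eq_zero_of_mem_map_algebraMap {R R' M : Type*} [CommRing R] [CommRing R']
    [Algebra R R'] [AddCommGroup M] [Module R M] {I : Ideal R} {t : R'}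
    (ht : t ∈ I.map (algebraMap R R')) (m : M) (hm : ∀ i ∈ I, i • m = 0) : t ⊗ₜ[R] m = 0 := by
  have : I.map (algebraMap R R') ≤
      LinearMap.ker (LinearMap.toSpanSingleton R' (R' ⊗[R] M) (1 ⊗ₜ m)) := by
    refine map_le_iff_le_comap.2 fun i hi ↦ ?_
    have e : algebraMap R R' i • ((1 : R') ⊗ₜ[R] m) = 0 := by
      rw [algebraMap_smul, ← tmul_smul, hm i hi, tmul_zero]
    exact e
  have h2 := this ht
  simpa [smul_tmul'] using h2

lemma mem_map_torsionOf_of_tmul_eq_zero {R R' M : Type*} [CommRing R] [CommRing R'] [Algebra R R']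
    [Module.Flat R R'] [AddCommGroup M] [Module R M] (x : M) (w : R') (h : w ⊗ₜ[R] x = 0) :
    w ∈ (torsionOf R M x).map (algebraMap R R') := by
  have hinj : Function.Injective
      ((torsionOf R M x).liftQ (LinearMap.toSpanSingleton R M x) le_rfl) :=
    LinearMap.ker_eq_bot.1 (Submodule.ker_liftQ_eq_bot _ _ _ le_rfl)
  have h1 : (Ideal.Quotient.mk (torsionOf R M x) 1) ⊗ₜ[R] w = 0 := by
    refine Module.Flat.rTensor_preserves_injective_linearMap (M := R') _ hinj ?_
    rw [map_zero, LinearMap.rTensor_tmul]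
    have e : (torsionOf R M x).liftQ (LinearMap.toSpanSingleton R M x) le_rfl
        (Ideal.Quotient.mk (torsionOf R M x) 1) = x := one_smul R x
    rw [e]
    exact (TensorProduct.comm R R' M).symm.injective.eq_iff.1 (by simpa using h)
  have h2 := congrArg (quotTensorEquivQuotSMul R' (torsionOf R M x)) h1
  rw [map_zero, quotTensorEquivQuotSMul_mk_tmul, one_smul, Submodule.Quotient.mk_eq_zero,
    smul_top_eq_map] at h2
  exact h2

lemma RingHom.Flat.mem_map_colon {R R' : Type*} [CommRing R] [CommRing R'] {φ : R →+* R'}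
    (hφ : φ.Flat) (J : Ideal R) (r : R) (s : R') (h : φ r * s ∈ J.map φ) :
    s ∈ (J.colon {r}).map φ := by
  algebraize [φ]
  have h0 : s ⊗ₜ[R] (Ideal.Quotient.mk J r) = 0 := by
    have e1 : Ideal.Quotient.mk J r = r • Ideal.Quotient.mk J 1 := by
      rw [Algebra.smul_def, Ideal.Quotient.algebraMap_eq, map_one, mul_one]
    have e2 : r • s = φ r * s := Algebra.smul_def r s
    rw [e1, tmul_smul, smul_tmul', e2]
    refine tmul_eq_zero_of_mem_map_algebraMap h _ fun i hi ↦ ?_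
    rw [Algebra.smul_def, Ideal.Quotient.algebraMap_eq, Ideal.Quotient.eq_zero_iff_mem.2 hi,
      zero_mul]
  have := mem_map_torsionOf_of_tmul_eq_zero _ s h0
  refine Ideal.map_mono ?_ this
  intro a ha
  have : Ideal.Quotient.mk J (a * r) = 0 := ha
  rw [Submodule.mem_colon_singleton]
  exact Ideal.Quotient.eq_zero_iff_mem.1 this

lemma RingHom.IsPureHom.of_flat_of_notMem {R R' : Type u} [CommRing R] [CommRing R']
    [IsLocalRing R] {φ : R →+* R'} (hφ : φ.Flat) {I : Ideal R} {I' : Ideal R'}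
    (ψ : R ⧸ I →+* R' ⧸ I') (hψ : ∀ r, ψ (Ideal.Quotient.mk I r) = Ideal.Quotient.mk I' (φ r))
    (w : R') (hw : ∀ s ∈ I', s * w ∈ I.map φ) (hwm : w ∉ (maximalIdeal R).map φ) :
    ψ.IsPureHom := by
  intro M _ _
  let : Module (R ⧸ I) (R' ⧸ I') := Module.compHom _ ψ
  let : Module R M := Module.compHom M (Ideal.Quotient.mk I)
  algebraize [φ]
  have hann (m : M) (t : R') (ht : t ∈ I.map φ) : t ⊗ₜ[R] m = 0 := by
    refine tmul_eq_zero_of_mem_map_algebraMap ht m fun i hi ↦ ?_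
    change Ideal.Quotient.mk I i • m = 0
    rw [Ideal.Quotient.eq_zero_iff_mem.2 hi, zero_smul]
  let f : M →+ (R' ⧸ I') →+ R' ⊗[R] M := AddMonoidHom.mk'
    (fun m ↦ (I'.liftQ (LinearMap.toSpanSingleton R' (R' ⊗[R] M) (w ⊗ₜ m)) fun s hs ↦ by
      simpa [smul_tmul'] using hann m _ (hw s hs)).toAddMonoidHom) fun m m' ↦ by
        ext s
        obtain ⟨s, rfl⟩ := Ideal.Quotient.mk_surjective s
        change s • (w ⊗ₜ[R] (m + m')) = s • (w ⊗ₜ[R] m) + s • (w ⊗ₜ[R] m')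
        rw [tmul_add, smul_add]
  let F : M ⊗[R ⧸ I] (R' ⧸ I') →+ R' ⊗[R] M := TensorProduct.liftAddHom f fun r m n ↦ by
    obtain ⟨r, rfl⟩ := Ideal.Quotient.mk_surjective r
    obtain ⟨n, rfl⟩ := Ideal.Quotient.mk_surjective n
    have e : Ideal.Quotient.mk I r • Ideal.Quotient.mk I' n =
        Ideal.Quotient.mk I' (φ r * n) := by
      rw [map_mul, ← hψ]; rfl
    rw [e]
    change n • (w ⊗ₜ[R] (r • m)) = (φ r * n) • (w ⊗ₜ[R] m)
    rw [tmul_smul, mul_comm, mul_smul]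
    congr 1
  have hker (m : M) (hm : m ⊗ₜ[R ⧸ I] (1 : R' ⧸ I') = 0) : m = 0 := by
    have h1 : F (m ⊗ₜ 1) = 0 := by rw [hm, map_zero]
    have h2 : F (m ⊗ₜ 1) = (1 : R') • (w ⊗ₜ[R] m) := rfl
    rw [h2, one_smul] at h1
    by_contra hm0
    refine hwm (Ideal.map_mono (le_maximalIdeal ?_) (mem_map_torsionOf_of_tmul_eq_zero m w h1))
    exact fun h ↦ hm0 ((torsionOf_eq_top_iff R m).1 h)
  intro a b hab
  refine sub_eq_zero.1 (hker _ ?_)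
  rw [sub_tmul]
  exact sub_eq_zero.2 hab

lemma RingHom.IsPureHom.mem_of_mem_map {S S' : Type u} [CommRing S] [CommRing S']
    {ψ : S →+* S'} (hψ : ψ.IsPureHom) (𝔞 : Ideal S) (x : S) (hx : ψ x ∈ 𝔞.map ψ) : x ∈ 𝔞 := by
  let : Module S S' := Module.compHom S' ψ
  have h := hψ (S ⧸ 𝔞)
  have hsmul (s : S) (t : S') : s • t = ψ s * t := rfl
  have hz (t : S') (ht : t ∈ 𝔞.map ψ) : ∀ s : S', (Ideal.Quotient.mk 𝔞 1) ⊗ₜ[S] (s * t) = 0 := by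
    refine Submodule.span_induction ?_ ?_ ?_ ?_ ht
    · rintro _ ⟨a, ha, rfl⟩ s
      have e1 : s * ψ a = a • s := by rw [hsmul, mul_comm]
      have e2 : a • Ideal.Quotient.mk 𝔞 1 = 0 := by
        rw [Algebra.smul_def, Ideal.Quotient.algebraMap_eq, Ideal.Quotient.eq_zero_iff_mem.2 ha,
          zero_mul]
      rw [e1, ← smul_tmul, e2, zero_tmul]
    · intro s
      rw [mul_zero, tmul_zero]
    · intro a b _ _ h1 h2 s
      rw [mul_add, tmul_add, h1, h2, add_zero]
    · intro c a _ h1 s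
      rw [smul_eq_mul, ← mul_assoc, h1]
  refine Ideal.Quotient.eq_zero_iff_mem.1 (h ?_)
  change Ideal.Quotient.mk 𝔞 x ⊗ₜ[S] (1 : S') = 0 ⊗ₜ 1
  have e : Ideal.Quotient.mk 𝔞 x = x • Ideal.Quotient.mk 𝔞 1 := by
    rw [Algebra.smul_def, Ideal.Quotient.algebraMap_eq, map_one, mul_one]
  rw [zero_tmul, e, smul_tmul, hsmul, mul_comm]
  exact hz _ hx 1

end Purity

section Powers
open IsLocalRing RingTheory.Sequence

lemma ofList_eq_of_perm {R : Type*} [CommRing R] {l l' : List R} (h : l.Perm l') :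
    ofList l = ofList l' := by
  simp only [ofList, h.mem_iff]

lemma isWeaklyRegular_append_singleton_iff {R : Type*} [CommRing R] (l : List R) (r : R) :
    IsWeaklyRegular R (l ++ [r]) ↔
      IsWeaklyRegular R l ∧ ∀ a, r * a ∈ ofList l → a ∈ ofList l := by
  rw [isWeaklyRegular_append_iff, isWeaklyRegular_singleton_iff,
    isSMulRegular_quotient_ofList_iff]

lemma mem_of_pow_mul_mem {R : Type*} [CommRing R] {J : Ideal R} {r : R}
    (h : ∀ a, r * a ∈ J → a ∈ J) (k : ℕ) (a : R) (ha : r ^ k * a ∈ J) : a ∈ J := by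
  induction k with
  | zero => simpa using ha
  | succ k ih => exact ih (h _ (by rwa [← mul_assoc, ← pow_succ']))

lemma mul_prod_map_pow_mem_ofList {R : Type*} [CommRing R] (l : List R) (k : ℕ) {x : R}
    (hx : x ∈ ofList l) :
    x * (l.map (· ^ k)).prod ∈ ofList (l.map (· ^ (k + 1))) := by
  classical
  refine Submodule.span_induction ?_ (by simp) ?_ ?_ hx
  · intro r hr
    have h1 : r * (l.map (· ^ k)).prod = r ^ (k + 1) * ((l.erase r).map (· ^ k)).prod := by
      rw [((List.perm_cons_erase hr).map _).prod_eq, List.map_cons, List.prod_cons]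
      ring
    rw [h1]
    exact mul_mem_right _ _ (subset_span (List.mem_map_of_mem hr))
  · intro a b _ _ ha hb
    rw [add_mul]
    exact add_mem ha hb
  · intro c a _ ha
    rw [smul_mul_assoc]
    exact Submodule.smul_mem _ c ha

variable {R : Type*} [CommRing R] [IsNoetherianRing R] [IsLocalRing R]

lemma RingTheory.Sequence.IsWeaklyRegular.append_map_pow {zs rs : List R}
    (h : IsWeaklyRegular R (zs ++ rs)) (hm : ∀ r ∈ zs ++ rs, r ∈ maximalIdeal R) {k : ℕ}
    (hk : k ≠ 0) : IsWeaklyRegular R (zs ++ rs.map (· ^ k)) := by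
  classical
  induction rs generalizing zs with
  | nil => simpa using h
  | cons r rs ih =>
    have h1 := isWeaklyRegular_of_perm_of_subset_maximalIdeal h
      (rs' := (zs ++ rs) ++ [r]) (List.perm_iff_count.2 fun x ↦ by
        simp only [List.count_append, List.count_cons, List.count_nil]; ring) hm
    rw [isWeaklyRegular_append_singleton_iff] at h1
    have h2 : IsWeaklyRegular R ((zs ++ rs) ++ [r ^ k]) :=
      (isWeaklyRegular_append_singleton_iff _ _).2 ⟨h1.1, fun a ↦ mem_of_pow_mul_mem h1.2 k a⟩
    have hr : r ^ k ∈ maximalIdeal R := pow_mem_of_mem _ (hm r (by simp)) k (by omega)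
    have hm2 : ∀ x ∈ (zs ++ rs) ++ [r ^ k], x ∈ maximalIdeal R := by
      intro x hx
      simp only [List.mem_append, List.mem_singleton] at hx
      rcases hx with (hx | hx) | rfl
      exacts [hm x (by simp [hx]), hm x (by simp [hx]), hr]
    have hp : ((zs ++ rs) ++ [r ^ k]).Perm ((zs ++ [r ^ k]) ++ rs) :=
      List.perm_iff_count.2 fun x ↦ by
        simp only [List.count_append, List.count_cons, List.count_nil]; ring
    have h3 := ih (isWeaklyRegular_of_perm_of_subset_maximalIdeal h2 hp hm2)
      fun x hx ↦ hm2 x (hp.mem_iff.2 hx)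
    simpa using h3

lemma mem_ofList_of_prod_map_pow_mul_mem {fs zs : List R} (h : IsWeaklyRegular R (fs ++ zs))
    (hm : ∀ r ∈ fs ++ zs, r ∈ maximalIdeal R) (k : ℕ) {a : R}
    (ha : (fs.map (· ^ k)).prod * a ∈ ofList (fs.map (· ^ (k + 1)) ++ zs)) :
    a ∈ ofList (fs ++ zs) := by
  classical
  induction fs generalizing zs with
  | nil => simpa using ha
  | cons r fs ih =>
    have hp1 : (r :: fs ++ zs).Perm ((zs ++ [r]) ++ fs) :=
      List.perm_iff_count.2 fun x ↦ by
        simp only [List.count_append, List.count_cons, List.count_nil]; ring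
    have h1 := (isWeaklyRegular_of_perm_of_subset_maximalIdeal h hp1 hm).append_map_pow
      (fun x hx ↦ hm x (hp1.mem_iff.2 hx)) k.succ_ne_zero
    have hp2 : ((zs ++ [r]) ++ fs.map (· ^ (k + 1))).Perm
      ((fs.map (· ^ (k + 1)) ++ zs) ++ [r]) :=
      List.perm_iff_count.2 fun x ↦ by
        simp only [List.count_append, List.count_cons, List.count_nil]; ring
    have h2 := isWeaklyRegular_of_perm_of_subset_maximalIdeal h1 hp2 (by
      intro x hx
      simp only [List.mem_append, List.mem_map, List.mem_singleton] at hx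
      rcases hx with (hx | rfl) | ⟨y, hy, rfl⟩
      exacts [hm x (by simp [hx]), hm _ (by simp),
        pow_mem_of_mem _ (hm y (by simp [hy])) _ k.succ_pos])
    rw [isWeaklyRegular_append_singleton_iff] at h2
    rw [List.map_cons, List.map_cons, List.prod_cons, List.cons_append, ofList_cons,
      Submodule.mem_sup] at ha
    obtain ⟨y, hy, z, hz, hyz⟩ := ha
    obtain ⟨c, rfl⟩ := mem_span_singleton'.1 hy
    have h3 : (fs.map (· ^ k)).prod * a - r * c ∈ ofList (fs.map (· ^ (k + 1)) ++ zs) := by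
      refine mem_of_pow_mul_mem h2.2 k _ ?_
      have : r ^ k * ((fs.map (· ^ k)).prod * a - r * c) = z := by
        linear_combination -hyz
      rwa [this]
    have hp3 : (fs ++ r :: zs).Perm (r :: fs ++ zs) :=
      List.perm_iff_count.2 fun x ↦ by
        simp only [List.count_append, List.count_cons]; ring
    rw [← ofList_eq_of_perm hp3]
    refine ih (isWeaklyRegular_of_perm_of_subset_maximalIdeal h hp3.symm hm)
      (fun x hx ↦ hm x (hp3.mem_iff.1 hx)) ?_
    have hp4 : (fs.map (· ^ (k + 1)) ++ r :: zs).Perm (r :: (fs.map (· ^ (k + 1)) ++ zs)) :=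
      List.perm_iff_count.2 fun x ↦ by
        simp only [List.count_append, List.count_cons]; ring
    rw [ofList_eq_of_perm hp4, ofList_cons, Submodule.mem_sup]
    exact ⟨r * c, mul_mem_right _ _ (mem_span_singleton_self r), _, h3, by ring⟩

lemma RingHom.Flat.of_isWeaklyRegular_map {R' : Type*} [CommRing R'] [IsNoetherianRing R']
    [IsLocalRing R'] (φ : R →+* R') [hloc : IsLocalHom φ] (l : List R)
    (hlm : ofList l = maximalIdeal R) (hl : IsWeaklyRegular R' (l.map φ)) : φ.Flat := by
  algebraize [φ]
  have : IsLocalHom (algebraMap R R') := hloc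
  have h1 : IsWeaklyRegular R' l := (isWeaklyRegular_map_algebraMap_iff R' R' l).1 hl
  have h2 := rTensor_subtype_ofList_injective_of_isWeaklyRegular l h1
  rw [hlm] at h2
  exact Module.Flat.of_rTensor_maximalIdeal_injective h2

lemma frobenius_flat_of_ofList_eq_maximalIdeal (p : ℕ) [Fact p.Prime] [CharP R p] (l : List R)
    (hlm : ofList l = maximalIdeal R) (hdim : (l.length : WithBot ℕ∞) ≤ ringKrullDim R) :
    (frobenius R p).Flat := by
  have hp : p ≠ 0 := (Fact.out : p.Prime).ne_zero
  have : IsLocalHom (frobenius R p) := ⟨fun a ha ↦ (isUnit_pow_iff hp).1 ha⟩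
  refine RingHom.Flat.of_isWeaklyRegular_map _ l hlm ?_
  have h := (isWeaklyRegular_of_ofList_eq_maximalIdeal l hlm hdim)
  exact RingTheory.Sequence.IsWeaklyRegular.append_map_pow (zs := []) h
    (fun r hr ↦ hlm ▸ subset_span hr) hp

end Powers

section FedderCriterion
open IsLocalRing RingTheory.Sequence

lemma exists_notMem_mul_mem_of_forall_exists {R : Type*} [CommRing R] [IsNoetherianRing R]
    (J 𝔪 : Ideal R) (h : ∀ z ∈ 𝔪, ∃ a ∉ J, z * a ∈ J) :
    ∃ u ∉ J, ∀ x ∈ 𝔪, x * u ∈ J := by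
  have hfin := associatedPrimes.finite R (R ⧸ J)
  have hsub : (𝔪 : Set R) ⊆ ⋃ P ∈ (hfin.toFinset : Set (Ideal R)), (P : Set R) := by
    rw [hfin.coe_toFinset, biUnion_associatedPrimes_eq_zero_divisors]
    intro z hz
    obtain ⟨a, ha, hza⟩ := h z hz
    exact ⟨Ideal.Quotient.mk J a, fun h0 ↦ ha (Ideal.Quotient.eq_zero_iff_mem.1 h0),
      Ideal.Quotient.eq_zero_iff_mem.2 hza⟩
  obtain ⟨P, hP, hle⟩ := (subset_union_prime (f := id) ⊥ ⊥ fun P hP _ _ ↦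
    IsAssociatedPrime.isPrime (hfin.mem_toFinset.1 hP)).1 hsub
  obtain ⟨hprime, u, hu⟩ := isAssociatedPrime_iff.1 (hfin.mem_toFinset.1 hP)
  obtain ⟨u, rfl⟩ := Ideal.Quotient.mk_surjective u
  have hmem (x : R) : x ∈ P ↔ x * u ∈ J := by
    rw [hu, Submodule.mem_colon_singleton, Submodule.mem_bot]
    exact Ideal.Quotient.eq_zero_iff_mem (a := x * u)
  refine ⟨u, fun h0 ↦ hprime.one_notMem ((hmem 1).2 (by rwa [one_mul])), fun x hx ↦ ?_⟩
  exact (hmem x).1 (hle hx)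

variable {R : Type*} [CommRing R] [IsNoetherianRing R] [IsLocalRing R]

lemma RingTheory.Sequence.IsWeaklyRegular.exists_append_socle {fs : List R}
    (h : IsWeaklyRegular R fs) (hm : ∀ r ∈ fs, r ∈ maximalIdeal R) :
    ∃ (ys : List R) (u : R), IsWeaklyRegular R (fs ++ ys) ∧ (∀ r ∈ ys, r ∈ maximalIdeal R) ∧
      u ∉ ofList (fs ++ ys) ∧ ∀ x ∈ maximalIdeal R, x * u ∈ ofList (fs ++ ys) := by
  obtain ⟨J, ⟨ys, hys, hreg, rfl⟩, hmax⟩ := set_has_maximal_iff_noetherian.2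
    (inferInstance : IsNoetherian R R)
    {J : Ideal R | ∃ ys : List R, (∀ r ∈ ys, r ∈ maximalIdeal R) ∧
      IsWeaklyRegular R (fs ++ ys) ∧ ofList (fs ++ ys) = J}
    ⟨_, [], by simp, by simpa using h, rfl⟩
  have hle : ofList (fs ++ ys) ≤ maximalIdeal R := by
    refine span_le.2 fun x hx ↦ ?_
    rcases List.mem_append.1 hx with hx | hx
    exacts [hm x hx, hys x hx]
  obtain ⟨u, hu, hux⟩ := exists_notMem_mul_mem_of_forall_exists (ofList (fs ++ ys))
    (maximalIdeal R) fun z hz ↦ by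
      by_contra! hcon
      have hreg' : IsWeaklyRegular R (fs ++ (ys ++ [z])) := by
        rw [← List.append_assoc, isWeaklyRegular_append_singleton_iff]
        exact ⟨hreg, fun a ha ↦ by_contra fun hna ↦ hcon a hna ha⟩
      have hle' : ofList (fs ++ ys) ≤ ofList (fs ++ (ys ++ [z])) := by
        rw [← List.append_assoc, ofList_append _ [z]]
        exact le_sup_left
      have hz' : z ∈ ofList (fs ++ ys) := by
        by_contra hzn
        refine hmax _ ⟨ys ++ [z], ?_, hreg', rfl⟩ (lt_of_le_of_ne hle' fun heq ↦ hzn ?_)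
        · intro r hr
          rcases List.mem_append.1 hr with hr | hr
          exacts [hys r hr, List.mem_singleton.1 hr ▸ hz]
        · rw [heq]
          exact subset_span (by simp)
      exact hcon 1 (fun h1 ↦ one_notMem (maximalIdeal R) (hle h1)) (by rwa [mul_one])
  exact ⟨ys, u, hreg, hys, hu, hux⟩

lemma prod_map_pow_notMem_map_frobenius_of_isPureHom {R : Type u} [CommRing R]
    [IsNoetherianRing R] [IsLocalRing R] (p : ℕ) [Fact p.Prime] [CharP R p] {fs : List R}
    [CharP (R ⧸ ofList fs) p] (h : IsWeaklyRegular R fs) (hm : ∀ r ∈ fs, r ∈ maximalIdeal R)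
    (hF : (frobenius (R ⧸ ofList fs) p).IsPureHom) :
    (fs.map (· ^ (p - 1))).prod ∉ (maximalIdeal R).map (frobenius R p) := by
  intro hw
  have hp : p ≠ 0 := (Fact.out : p.Prime).ne_zero
  have hp1 : p - 1 + 1 = p := by omega
  obtain ⟨ys, u, hreg, hys, hu, hux⟩ := h.exists_append_socle hm
  have hmy : ∀ r ∈ fs ++ ys, r ∈ maximalIdeal R := by
    intro r hr
    rcases List.mem_append.1 hr with hr | hr
    exacts [hm r hr, hys r hr]
  have h1 : (fs.map (· ^ (p - 1))).prod * u ^ p ∈ (ofList (fs ++ ys)).map (frobenius R p) := by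
    refine Submodule.span_induction (p := fun w _ ↦
      w * u ^ p ∈ (ofList (fs ++ ys)).map (frobenius R p)) ?_ (by simp) ?_ ?_ hw
    · rintro _ ⟨x, hx, rfl⟩
      rw [frobenius_def, ← mul_pow]
      exact mem_map_of_mem (frobenius R p) (hux x hx)
    · intro a b _ _ ha hb
      rw [add_mul]
      exact add_mem ha hb
    · intro c a _ ha
      rw [smul_mul_assoc]
      exact Submodule.smul_mem _ c ha
  have h2 := mem_ofList_of_prod_map_pow_mul_mem (zs := ys.map (· ^ p)) (k := p - 1) (a := u ^ p)
    (hreg.append_map_pow hmy hp) (by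
      intro r hr
      rcases List.mem_append.1 hr with hr | hr
      · exact hm r hr
      · obtain ⟨y, hy, rfl⟩ := List.mem_map.1 hr
        exact pow_mem_of_mem _ (hys y hy) p (by omega))
    (by
      rw [map_ofList, List.map_append] at h1
      rwa [hp1])
  have h3 : frobenius _ p (Ideal.Quotient.mk (ofList fs) u) ∈
      ((ofList (fs ++ ys)).map (Ideal.Quotient.mk (ofList fs))).map (frobenius _ p) := by
    have h4 := mem_map_of_mem (Ideal.Quotient.mk (ofList fs)) h2
    rw [map_pow, map_ofList] at h4
    rw [map_ofList, map_ofList, frobenius_def]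
    refine span_le.2 ?_ h4
    intro x hx
    simp only [List.map_append, List.mem_append, List.mem_map, Set.mem_ofPred_eq] at hx
    rcases hx with ⟨y, hy, rfl⟩ | ⟨_, ⟨y, hy, rfl⟩, rfl⟩
    · rw [Ideal.Quotient.eq_zero_iff_mem.2 (show y ∈ ofList fs from subset_span hy)]
      exact zero_mem _
    · refine subset_span ?_
      simp only [List.map_append, List.mem_append, List.mem_map, Set.mem_ofPred_eq, map_pow]
      exact Or.inr ⟨_, ⟨y, hy, rfl⟩, rfl⟩
  have h5 := hF.mem_of_mem_map _ _ h3
  rw [Ideal.mem_quotient_iff_mem (by rw [ofList_append]; exact le_sup_left)] at h5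
  exact hu h5

lemma isPureHom_frobenius_quotient_of_prod_notMem {R : Type u} [CommRing R] [IsLocalRing R]
    (p : ℕ) [Fact p.Prime] [CharP R p] (hφ : (frobenius R p).Flat) {fs : List R}
    [CharP (R ⧸ ofList fs) p]
    (hw : (fs.map (· ^ (p - 1))).prod ∉ (maximalIdeal R).map (frobenius R p)) :
    (frobenius (R ⧸ ofList fs) p).IsPureHom := by
  have hp1 : p - 1 + 1 = p := Nat.sub_add_cancel (Fact.out : p.Prime).one_le
  refine RingHom.IsPureHom.of_flat_of_notMem hφ _ (fun r ↦ ?_) _ (fun s hs ↦ ?_) hw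
  · simp only [frobenius_def, map_pow]
  · have := mul_prod_map_pow_mem_ofList fs (p - 1) hs
    rw [hp1] at this
    rwa [map_ofList]

lemma isWeaklyRegular_of_prod_notMem {R : Type*} [CommRing R] [IsLocalRing R]
    (p : ℕ) [Fact p.Prime] [CharP R p] (hφ : (frobenius R p).Flat) {fs : List R}
    (hw : (fs.map (· ^ (p - 1))).prod ∉ (maximalIdeal R).map (frobenius R p)) :
    IsWeaklyRegular R fs := by
  have hp2 : 2 ≤ p := (Fact.out : p.Prime).two_le
  rw [isWeaklyRegular_iff]
  intro i hi
  rw [isSMulRegular_quotient_ofList_iff]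
  intro r hr
  by_contra hrn
  set J := ofList (fs.take i) with hJ
  have h1 : frobenius R p r * (fs.map (· ^ (p - 1))).prod ∈ J.map (frobenius R p) := by
    have e : fs = fs.take i ++ fs[i] :: fs.drop (i + 1) := by
      rw [← List.drop_eq_getElem_cons hi, List.take_append_drop]
    have h2 := mul_prod_map_pow_mem_ofList (fs.take i) (p - 1) hr
    rw [Nat.sub_add_cancel (by omega)] at h2
    have h3 : frobenius R p r * (fs.map (· ^ (p - 1))).prod =
        (r ^ (p - 1) * fs[i] ^ (p - 2) * ((fs.drop (i + 1)).map (· ^ (p - 1))).prod) *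
          (fs[i] * r * ((fs.take i).map (· ^ (p - 1))).prod) := by
      conv_lhs => rw [e, List.map_append, List.map_cons, List.prod_append, List.prod_cons]
      obtain ⟨q, rfl⟩ := Nat.exists_eq_add_of_le hp2
      rw [frobenius_def, show 2 + q - 1 = q + 1 by omega, show 2 + q - 2 = q by omega]
      ring
    rw [h3, map_ofList]
    exact mul_mem_left _ _ h2
  refine hw (map_mono (le_maximalIdeal fun htop ↦ hrn ?_) (hφ.mem_map_colon J r _ h1))
  have := htop ▸ (Submodule.mem_top : (1 : R) ∈ ⊤)
  simpa [Submodule.mem_colon_singleton] using this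

lemma prod_map_pow_notMem_map_iterateFrobenius {R : Type*} [CommRing R] [IsLocalRing R]
    (p : ℕ) [Fact p.Prime] [CharP R p] (hφ : (frobenius R p).Flat) {fs : List R}
    (hw : (fs.map (· ^ (p - 1))).prod ∉ (maximalIdeal R).map (frobenius R p)) (e : ℕ) :
    (fs.map (· ^ (p ^ e - 1))).prod ∉ (maximalIdeal R).map (iterateFrobenius R p e) := by
  have hp1 : 1 ≤ p := (Fact.out : p.Prime).one_le
  induction e with
  | zero =>
    have h1 : iterateFrobenius R p 0 = RingHom.id R := by ext; simp
    rw [h1, Ideal.map_id]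
    simp
  | succ e ih =>
    intro hmem
    have h1 : iterateFrobenius R p (e + 1) = (frobenius R p).comp (iterateFrobenius R p e) := by
      ext x
      simp [iterateFrobenius_def, frobenius_def, pow_succ, pow_mul]
    have h2 : p ^ (e + 1) - 1 = (p ^ e - 1) * p + (p - 1) := by
      obtain ⟨k, hk⟩ := Nat.exists_eq_add_of_le (Nat.one_le_pow e p hp1)
      rw [pow_succ, hk, Nat.add_sub_cancel_left, add_mul, one_mul]
      omega
    have h3 : (fs.map (· ^ (p ^ (e + 1) - 1))).prod =
        frobenius R p (fs.map (· ^ (p ^ e - 1))).prod * (fs.map (· ^ (p - 1))).prod := by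
      rw [map_list_prod, List.map_map, ← List.prod_map_mul, h2]
      simp only [Function.comp_def, frobenius_def, pow_add, pow_mul]
    rw [h1, ← Ideal.map_map, h3] at hmem
    refine hw (map_mono (le_maximalIdeal fun htop ↦ ih ?_) (hφ.mem_map_colon _ _ _ hmem))
    have := htop ▸ (Submodule.mem_top : (1 : R) ∈ ⊤)
    simpa [Submodule.mem_colon_singleton] using this

end FedderCriterion

section Volume
open IsLocalRing RingTheory.Sequence

lemma Ideal.frobPow_eq_map_iterateFrobenius {R : Type*} [CommRing R] (p : ℕ) [Fact p.Prime]
    [CharP R p] (J : Ideal R) (e : ℕ) : J.frobPow (p ^ e) = J.map (iterateFrobenius R p e) :=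
  rfl

lemma mem_Vnu_span_singleton_iff {R : Type*} [CommRing R] {t : ℕ} (f : Fin t → R) (J : Ideal R)
    (a : Fin t → ℕ) : a ∈ Vnu (fun i ↦ span {f i}) J ↔ ∏ i, f i ^ a i ∉ J := by
  simp only [Vnu, Set.mem_ofPred_eq, span_singleton_pow, prod_span_singleton,
    span_singleton_le_iff_mem]

lemma Vnu_frobPow_subset_piFinset_range {R : Type*} [CommRing R] {t : ℕ} (f : Fin t → R)
    (J : Ideal R) (hf : ∀ i, f i ∈ J) (q : ℕ) :
    Vnu (fun i ↦ span {f i}) (J.frobPow q) ⊆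
      (Fintype.piFinset fun _ : Fin t ↦ Finset.range q : Finset (Fin t → ℕ)) := by
  intro a ha
  rw [mem_Vnu_span_singleton_iff] at ha
  simp only [Finset.mem_coe, Fintype.mem_piFinset, Finset.mem_range]
  by_contra! hcon
  obtain ⟨i, hi⟩ := hcon
  exact ha (mem_of_dvd _ ((pow_dvd_pow _ hi).trans (Finset.dvd_prod_of_mem _ (Finset.mem_univ i)))
    (subset_span ⟨f i, hf i, rfl⟩))

lemma ncard_Vnu_frobPow_of_prod_notMem {R : Type*} [CommRing R] {t : ℕ} (f : Fin t → R)
    (J : Ideal R) (hf : ∀ i, f i ∈ J) (q : ℕ) (h : ∏ i, f i ^ (q - 1) ∉ J.frobPow q) :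
    (Vnu (fun i ↦ span {f i}) (J.frobPow q)).ncard = q ^ t := by
  have : Vnu (fun i ↦ span {f i}) (J.frobPow q) =
      (Fintype.piFinset fun _ : Fin t ↦ Finset.range q : Finset (Fin t → ℕ)) := by
    refine (Vnu_frobPow_subset_piFinset_range f J hf q).antisymm fun a ha ↦ ?_
    rw [mem_Vnu_span_singleton_iff]
    simp only [Finset.mem_coe, Fintype.mem_piFinset, Finset.mem_range] at ha
    exact fun hmem ↦ h (mem_of_dvd _
      (Finset.prod_dvd_prod_of_dvd _ _ fun i _ ↦ pow_dvd_pow _ (Nat.le_sub_one_of_lt (ha i))) hmem)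
  rw [this, Set.ncard_coe_finset, Fintype.card_piFinset]
  simp

lemma ncard_Vnu_frobPow_add_le_of_prod_mem {R : Type*} [CommRing R] {t : ℕ} (f : Fin t → R)
    (J : Ideal R) (hf : ∀ i, f i ∈ J) (q k : ℕ) (hk : k ≤ q)
    (h : ∏ i, f i ^ (q - k) ∈ J.frobPow q) :
    (Vnu (fun i ↦ span {f i}) (J.frobPow q)).ncard + k ^ t ≤ q ^ t := by
  classical
  set A : Finset (Fin t → ℕ) := Fintype.piFinset fun _ ↦ Finset.range q with hA
  set B : Finset (Fin t → ℕ) := Fintype.piFinset fun _ ↦ Finset.Ico (q - k) q with hB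
  have hBA : B ⊆ A := Fintype.piFinset_subset _ _ fun _ x hx ↦
    Finset.mem_range.2 (Finset.mem_Ico.1 hx).2
  have hsub : Vnu (fun i ↦ span {f i}) (J.frobPow q) ⊆ ((A \ B : Finset (Fin t → ℕ)) : Set _) := by
    intro a ha
    rw [Finset.coe_sdiff]
    refine ⟨Vnu_frobPow_subset_piFinset_range f J hf q ha, fun haB ↦ ?_⟩
    rw [mem_Vnu_span_singleton_iff] at ha
    simp only [hB, Finset.mem_coe, Fintype.mem_piFinset, Finset.mem_Ico] at haB
    exact ha (mem_of_dvd _ (Finset.prod_dvd_prod_of_dvd _ _ fun i _ ↦ pow_dvd_pow _ (haB i).1) h)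
  have h1 := Set.ncard_le_ncard hsub (Finset.finite_toSet _)
  rw [Set.ncard_coe_finset] at h1
  have h2 := Finset.card_sdiff_add_card_eq_card hBA
  have h3 : A.card = q ^ t := by simp [hA]
  have h4 : B.card = k ^ t := by simp [hB, Nat.sub_sub_self hk]
  omega

lemma tendsto_ncard_Vnu_frobPow_iff {R : Type*} [CommRing R] [IsLocalRing R] (p : ℕ)
    [Fact p.Prime] [CharP R p] (hφ : (frobenius R p).Flat) {t : ℕ} (f : Fin t → R)
    (hf : ∀ i, f i ∈ maximalIdeal R) :
    Tendsto (fun e : ℕ ↦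
        ((Vnu (fun i ↦ span {f i}) ((maximalIdeal R).frobPow (p ^ e))).ncard : ℝ) /
          (p : ℝ) ^ (e * t)) atTop (nhds 1) ↔
      ((List.ofFn f).map (· ^ (p - 1))).prod ∉ (maximalIdeal R).map (frobenius R p) := by
  have hp : 1 ≤ p := (Fact.out : p.Prime).one_le
  have hp0 : (0 : ℝ) < p := by exact_mod_cast hp
  have hprod (k : ℕ) : ((List.ofFn f).map (· ^ k)).prod = ∏ i, f i ^ k := by
    rw [List.map_ofFn, List.prod_ofFn]
    rfl
  constructor
  · intro hlim hmem
    rw [hprod] at hmem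
    have hle (e : ℕ) : ((Vnu (fun i ↦ span {f i})
        ((maximalIdeal R).frobPow (p ^ (e + 1)))).ncard : ℝ) / (p : ℝ) ^ ((e + 1) * t) ≤
          1 - 1 / (p : ℝ) ^ t := by
      have h1 : ∏ i, f i ^ (p ^ (e + 1) - p ^ e) ∈ (maximalIdeal R).frobPow (p ^ (e + 1)) := by
        have h2 : p ^ (e + 1) - p ^ e = (p - 1) * p ^ e := by
          rw [pow_succ', Nat.sub_mul, one_mul]
        have h3 : (iterateFrobenius R p e).comp (frobenius R p) = iterateFrobenius R p (e + 1) := by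
          ext x
          simp [iterateFrobenius_def, frobenius_def, pow_succ', pow_mul]
        rw [frobPow_eq_map_iterateFrobenius, ← h3, ← Ideal.map_map, h2]
        have h4 := mem_map_of_mem (iterateFrobenius R p e) hmem
        simpa only [map_prod, iterateFrobenius_def, ← pow_mul] using h4
      have h5 := ncard_Vnu_frobPow_add_le_of_prod_mem f _ hf _ (p ^ e)
        (Nat.pow_le_pow_right hp e.le_succ) h1
      have h6 : ((Vnu (fun i ↦ span {f i})
        ((maximalIdeal R).frobPow (p ^ (e + 1)))).ncard : ℝ) + ((p : ℝ) ^ e) ^ t ≤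
          ((p : ℝ) ^ (e + 1)) ^ t := by exact_mod_cast h5
      have h7 : (1 - 1 / (p : ℝ) ^ t) * (p : ℝ) ^ ((e + 1) * t) =
          ((p : ℝ) ^ (e + 1)) ^ t - ((p : ℝ) ^ e) ^ t := by
        rw [← pow_mul, ← pow_mul, add_mul, one_mul, pow_add]
        field_simp
      rw [div_le_iff₀ (by positivity), h7]
      linarith
    have h8 := le_of_tendsto' ((tendsto_add_atTop_iff_nat 1).2 hlim) hle
    have h9 : (0 : ℝ) < 1 / (p : ℝ) ^ t := by positivity
    linarith
  · intro hw
    refine tendsto_const_nhds.congr fun e ↦ ?_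
    have h1 := prod_map_pow_notMem_map_iterateFrobenius p hφ hw e
    rw [hprod] at h1
    rw [ncard_Vnu_frobPow_of_prod_notMem f _ hf _ h1, Nat.cast_pow, Nat.cast_pow, ← pow_mul,
      div_self (by positivity)]

end Volume

/-- For `(R,𝔪)` regular local and `f₁,…,f_t` minimal generators of `I ⊆ 𝔪`:
`Vol_F^𝔪(f₁,…,f_t) = 1` iff `f₁,…,f_t` is a regular sequence and `R/I` is F-pure
(i.e. `I` is an F-pure complete intersection). -/
theorem stmt16 {R : Type u} [CommRing R] [IsNoetherianRing R] [IsLocalRing R]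
    (hreg : ∃ (n : ℕ) (g : Fin n → R), ringKrullDim R = (n : WithBot (WithTop ℕ)) ∧
      Ideal.span (Set.range g) = IsLocalRing.maximalIdeal R)
    (p : ℕ) [Fact p.Prime] [CharP R p] {t : ℕ} (f : Fin t → R) (I : Ideal R)
    [CharP (R ⧸ I) p] (hIm : I ≤ IsLocalRing.maximalIdeal R)
    (hgen : Ideal.span (Set.range f) = I)
    (hmin : ∀ s : Finset R, Ideal.span (s : Set R) = I → t ≤ s.card) :
    Tendsto
      (fun e : ℕ =>
        ((Vnu (fun i => Ideal.span {f i})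
            ((IsLocalRing.maximalIdeal R).frobPow (p ^ e))).ncard : ℝ) / (p : ℝ) ^ (e * t))
      atTop (nhds 1) ↔
    (RingTheory.Sequence.IsRegular R (List.ofFn f) ∧ IsFPure p (R ⧸ I)) := by
  subst hgen
  have hlist {n : ℕ} (g : Fin n → R) : span (Set.range g) = ofList (List.ofFn g) := by
    simp only [ofList, List.mem_ofFn', Set.ofPred_mem_eq]
  obtain ⟨n, g, hdim, hg⟩ := hreg
  have hφ : (frobenius R p).Flat := by
    refine frobenius_flat_of_ofList_eq_maximalIdeal p (List.ofFn g) (by rw [← hlist, hg]) ?_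
    rw [hdim, List.length_ofFn]
    rfl
  have hf (i : Fin t) : f i ∈ IsLocalRing.maximalIdeal R := hIm (subset_span ⟨i, rfl⟩)
  have hf' : ∀ r ∈ List.ofFn f, r ∈ IsLocalRing.maximalIdeal R := by
    intro r hr
    obtain ⟨i, rfl⟩ := (List.mem_ofFn' f r).1 hr
    exact hf i
  rw [tendsto_ncard_Vnu_frobPow_iff p hφ f hf,
    IsLocalRing.isRegular_iff_isWeaklyRegular_of_subset_maximalIdeal hf']
  have key (I : Ideal R) (hI : I = ofList (List.ofFn f)) [CharP (R ⧸ I) p] :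
      ((List.ofFn f).map (· ^ (p - 1))).prod ∉
          (IsLocalRing.maximalIdeal R).map (frobenius R p) ↔
        RingTheory.Sequence.IsWeaklyRegular R (List.ofFn f) ∧ IsFPure p (R ⧸ I) := by
    subst hI
    exact ⟨fun hw ↦ ⟨isWeaklyRegular_of_prod_notMem p hφ hw,
      isPureHom_frobenius_quotient_of_prod_notMem p hφ hw⟩,
      fun h ↦ prod_map_pow_notMem_map_frobenius_of_isPureHom p h.1 hf' h.2⟩
  exact key _ (hlist f)
end

section
/- In R = K[[x,y]] with K a field of characteristic 2, let 𝔪 = (x,y), f = (x, y²) and g = (x, y² + x). Then Vol_F^𝔪(x, y²) = 1/2 while Vol_F^𝔪(x, y² + x) = 3/4. In particular, the F-volume of a sequence of generators of an ideal depends on the choice of generators, since (x, y²) = (x, y² + x) as ideals. -/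
open Ideal Filter MeasureTheory

theorem Ideal.frobPow_span_pair {R : Type*} [CommRing R] (p : ℕ) [Fact p.Prime] [CharP R p]
    (x y : R) (e : ℕ) :
    (Ideal.span {x, y}).frobPow (p ^ e) = Ideal.span {x ^ p ^ e, y ^ p ^ e} := by
  apply le_antisymm
  · refine Ideal.span_le.2 ?_
    rintro _ ⟨a, ha, rfl⟩
    obtain ⟨u, v, rfl⟩ := Ideal.mem_span_pair.1 ha
    refine Ideal.mem_span_pair.2 ⟨u ^ p ^ e, v ^ p ^ e, ?_⟩
    simp only [add_pow_char_pow, mul_pow]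
  · refine Ideal.span_le.2 ?_
    rintro _ (rfl | rfl)
    · exact Ideal.subset_span ⟨x, Ideal.subset_span (by simp), rfl⟩
    · exact Ideal.subset_span ⟨y, Ideal.subset_span (by simp), rfl⟩

theorem mem_Vnu_span_pair {R : Type*} [CommRing R] (f g : R) (J : Ideal R) (a : Fin 2 → ℕ) :
    a ∈ Vnu ![Ideal.span {f}, Ideal.span {g}] J ↔ f ^ a 0 * g ^ a 1 ∉ J := by
  simp [Vnu, Fin.prod_univ_two, Ideal.span_singleton_pow, Ideal.span_singleton_mul_span_singleton]

theorem MvPowerSeries.X_pow_mul_X_pow_notMem {K : Type*} [Field K] {q i j : ℕ}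
    (hi : i < q) (hj : j < q) :
    (X 0 : MvPowerSeries (Fin 2) K) ^ i * X 1 ^ j ∉
      Ideal.span {(X 0 : MvPowerSeries (Fin 2) K) ^ q, X 1 ^ q} := by
  intro h
  obtain ⟨u, v, huv⟩ := Ideal.mem_span_pair.1 h
  have hc := congrArg (coeff (Finsupp.single 0 i + Finsupp.single 1 j)) huv
  have h0 : ¬ (Finsupp.single (0 : Fin 2) q ≤ Finsupp.single 0 i + Finsupp.single 1 j) := by
    intro h
    have := h 0
    simp at this
    omega
  have h1 : ¬ (Finsupp.single (1 : Fin 2) q ≤ Finsupp.single 0 i + Finsupp.single 1 j) := by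
    intro h
    have := h 1
    simp at this
    omega
  simp [X_pow_eq, coeff_mul_monomial, h0, h1, monomial_mul_monomial, coeff_monomial_same] at hc

theorem pow_mul_pow_mem_span_pair_of_le {R : Type*} [CommRing R] (x y : R) {q i j : ℕ}
    (h : q ≤ i ∨ q ≤ j) : x ^ i * y ^ j ∈ Ideal.span {x ^ q, y ^ q} := by
  rcases h with h | h
  · exact Ideal.mul_mem_right _ _ (Ideal.mem_of_dvd _ (pow_dvd_pow x h)
      (Ideal.subset_span (by simp)))
  · exact Ideal.mul_mem_left _ _ (Ideal.mem_of_dvd _ (pow_dvd_pow y h)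
      (Ideal.subset_span (by simp)))

theorem MvPowerSeries.X_pow_mul_add_pow_notMem {K : Type*} [Field K] {q a b : ℕ}
    (ha : a < q) (hb : 2 * b < q) :
    (X 0 : MvPowerSeries (Fin 2) K) ^ a * (X 1 ^ 2 + X 0) ^ b ∉
      Ideal.span {(X 0 : MvPowerSeries (Fin 2) K) ^ q, X 1 ^ q} := by
  intro h
  apply X_pow_mul_X_pow_notMem (K := K) (i := q - 1) (by omega) hb
  obtain ⟨w, hw⟩ : (X 0 : MvPowerSeries (Fin 2) K) ∣ (X 1 ^ 2 + X 0) ^ b - (X 1 ^ 2) ^ b := by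
    have h := sub_dvd_pow_sub_pow (X 1 ^ 2 + X 0 : MvPowerSeries (Fin 2) K) (X 1 ^ 2) b
    rwa [add_sub_cancel_left] at h
  obtain ⟨c, rfl⟩ : ∃ c, q = a + c + 1 := ⟨q - 1 - a, by omega⟩
  have hmul := Ideal.mul_mem_left _ (X 0 ^ c) h
  have hx : (X 0 : MvPowerSeries (Fin 2) K) ^ (a + c + 1) * w ∈
      Ideal.span {(X 0 : MvPowerSeries (Fin 2) K) ^ (a + c + 1), X 1 ^ (a + c + 1)} :=
    Ideal.mul_mem_right _ _ (Ideal.subset_span (by simp))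
  convert Ideal.sub_mem _ hmul hx using 1
  rw [Nat.add_sub_cancel, pow_mul]
  linear_combination -(X 0 : MvPowerSeries (Fin 2) K) ^ (a + c) * hw

theorem MvPowerSeries.X_pow_mul_sq_add_pow_notMem_iff {K : Type*} [Field K] [CharP K 2]
    (n a b : ℕ) :
    (X 0 : MvPowerSeries (Fin 2) K) ^ a * (X 1 ^ 2 + X 0) ^ b ∉
      Ideal.span {(X 0 : MvPowerSeries (Fin 2) K) ^ 2 ^ (n + 1), X 1 ^ 2 ^ (n + 1)} ↔
    (a < 2 ^ (n + 1) ∧ b < 2 ^ n) ∨ (a < 2 ^ n ∧ 2 ^ n ≤ b ∧ b < 2 ^ (n + 1)) := by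
  have : CharP (MvPowerSeries (Fin 2) K) 2 :=
    charP_of_injective_algebraMap (algebraMap K (MvPowerSeries (Fin 2) K)).injective 2
  set J := Ideal.span {(X 0 : MvPowerSeries (Fin 2) K) ^ 2 ^ (n + 1), X 1 ^ 2 ^ (n + 1)}
  have hq : 2 ^ (n + 1) = 2 * 2 ^ n := by ring
  have hpow : (X 1 ^ 2 + X 0 : MvPowerSeries (Fin 2) K) ^ 2 ^ n =
      X 1 ^ 2 ^ (n + 1) + X 0 ^ 2 ^ n := by
    rw [add_pow_char_pow, ← pow_mul, hq]
  have hx : (X 0 : MvPowerSeries (Fin 2) K) ^ 2 ^ (n + 1) ∈ J := Ideal.subset_span (by simp)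
  have hy : (X 1 : MvPowerSeries (Fin 2) K) ^ 2 ^ (n + 1) ∈ J := Ideal.subset_span (by simp)
  rcases lt_or_ge a (2 ^ (n + 1)) with ha | ha
  swap
  · have : (X 0 : MvPowerSeries (Fin 2) K) ^ a * (X 1 ^ 2 + X 0) ^ b ∈ J :=
      Ideal.mul_mem_right _ _ (Ideal.mem_of_dvd _ (pow_dvd_pow _ ha) hx)
    simp only [this, not_true_eq_false, false_iff]
    omega
  rcases lt_or_ge b (2 ^ n) with hb | hb
  · simpa [ha, hb] using X_pow_mul_add_pow_notMem (K := K) ha (b := b) (by omega)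
  obtain ⟨b, rfl⟩ := Nat.exists_eq_add_of_le hb
  have key : (X 0 : MvPowerSeries (Fin 2) K) ^ a * (X 1 ^ 2 + X 0) ^ (2 ^ n + b) ∈ J ↔
      (X 0 : MvPowerSeries (Fin 2) K) ^ (a + 2 ^ n) * (X 1 ^ 2 + X 0) ^ b ∈ J := by
    rw [pow_add _ (2 ^ n) b, hpow]
    rw [show (X 0 : MvPowerSeries (Fin 2) K) ^ a *
        ((X 1 ^ 2 ^ (n + 1) + X 0 ^ 2 ^ n) * (X 1 ^ 2 + X 0) ^ b) =
        X 0 ^ a * (X 1 ^ 2 + X 0) ^ b * X 1 ^ 2 ^ (n + 1) +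
        X 0 ^ (a + 2 ^ n) * (X 1 ^ 2 + X 0) ^ b by ring]
    exact Ideal.add_mem_iff_right _ (Ideal.mul_mem_left _ _ hy)
  rw [key]
  rcases lt_or_ge a (2 ^ n) with ha' | ha'
  · rcases lt_or_ge b (2 ^ n) with hb' | hb'
    · have := X_pow_mul_add_pow_notMem (K := K) (q := 2 ^ (n + 1)) (a := a + 2 ^ n) (b := b)
        (by omega) (by omega)
      exact iff_of_true this (by omega)
    · refine iff_of_false (not_not.2 ?_) (by omega)
      obtain ⟨c, rfl⟩ := Nat.exists_eq_add_of_le hb'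
      rw [pow_add _ (2 ^ n) c, hpow]
      convert Ideal.add_mem _
        (Ideal.mul_mem_left _ (X 0 ^ (a + 2 ^ n) * (X 1 ^ 2 + X 0) ^ c) hy)
        (Ideal.mul_mem_left _ (X 0 ^ a * (X 1 ^ 2 + X 0) ^ c) hx) using 1
      rw [hq]
      ring
  · refine iff_of_false (not_not.2 ?_) (by omega)
    exact Ideal.mul_mem_right _ _ (Ideal.mem_of_dvd _ (pow_dvd_pow _ (by omega)) hx)

theorem card_piFinset_pair (s t : Finset ℕ) :
    (Fintype.piFinset ![s, t]).card = s.card * t.card := by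
  simp [Fintype.card_piFinset, Fin.prod_univ_two]

theorem mem_piFinset_pair {s t : Finset ℕ} {a : Fin 2 → ℕ} :
    a ∈ Fintype.piFinset ![s, t] ↔ a 0 ∈ s ∧ a 1 ∈ t := by
  simp [Fintype.mem_piFinset, Fin.forall_fin_two]

/-- In `R = K[[x,y]]`, `char K = 2`: `Vol_F^𝔪(x, y²) = 1/2` while `Vol_F^𝔪(x, y²+x) = 3/4`,
even though `(x, y²) = (x, y²+x)` as ideals. -/
theorem stmt19 (K : Type*) [Field K] [CharP K 2] :
    Tendsto
      (fun e : ℕ =>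
        ((Vnu
            ![Ideal.span {(MvPowerSeries.X 0 : MvPowerSeries (Fin 2) K)},
              Ideal.span {(MvPowerSeries.X 1 : MvPowerSeries (Fin 2) K) ^ 2}]
            ((Ideal.span {(MvPowerSeries.X 0 : MvPowerSeries (Fin 2) K),
                MvPowerSeries.X 1}).frobPow (2 ^ e))).ncard : ℝ) / (4 : ℝ) ^ e)
      atTop (nhds (1 / 2)) ∧
    Tendsto
      (fun e : ℕ =>
        ((Vnu
            ![Ideal.span {(MvPowerSeries.X 0 : MvPowerSeries (Fin 2) K)},
              Ideal.span {(MvPowerSeries.X 1 : MvPowerSeries (Fin 2) K) ^ 2 +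
                MvPowerSeries.X 0}]
            ((Ideal.span {(MvPowerSeries.X 0 : MvPowerSeries (Fin 2) K),
                MvPowerSeries.X 1}).frobPow (2 ^ e))).ncard : ℝ) / (4 : ℝ) ^ e)
      atTop (nhds (3 / 4)) ∧
    Ideal.span {(MvPowerSeries.X 0 : MvPowerSeries (Fin 2) K),
        (MvPowerSeries.X 1 : MvPowerSeries (Fin 2) K) ^ 2} =
      Ideal.span {(MvPowerSeries.X 0 : MvPowerSeries (Fin 2) K),
        (MvPowerSeries.X 1 : MvPowerSeries (Fin 2) K) ^ 2 + MvPowerSeries.X 0} := by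
  have : CharP (MvPowerSeries (Fin 2) K) 2 :=
    charP_of_injective_algebraMap (algebraMap K (MvPowerSeries (Fin 2) K)).injective 2
  refine ⟨?_, ?_, ?_⟩
  · refine tendsto_const_nhds.congr' ?_
    filter_upwards [eventually_ge_atTop 1] with e he
    obtain ⟨n, rfl⟩ := Nat.exists_eq_add_of_le' he
    rw [Ideal.frobPow_span_pair]
    have hset : Vnu
        ![Ideal.span {(MvPowerSeries.X 0 : MvPowerSeries (Fin 2) K)},
          Ideal.span {(MvPowerSeries.X 1 : MvPowerSeries (Fin 2) K) ^ 2}]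
        (Ideal.span {(MvPowerSeries.X 0 : MvPowerSeries (Fin 2) K) ^ 2 ^ (n + 1),
          MvPowerSeries.X 1 ^ 2 ^ (n + 1)}) =
        ↑(Fintype.piFinset ![Finset.range (2 ^ (n + 1)), Finset.range (2 ^ n)]) := by
      ext a
      rw [mem_Vnu_span_pair, Finset.mem_coe, mem_piFinset_pair, Finset.mem_range,
        Finset.mem_range, ← pow_mul]
      constructor
      · intro h
        by_contra hlt
        exact h (pow_mul_pow_mem_span_pair_of_le _ _ (by rw [pow_succ] at *; omega))
      · rintro ⟨h0, h1⟩
        exact MvPowerSeries.X_pow_mul_X_pow_notMem h0 (by rw [pow_succ]; omega)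
    rw [hset, Set.ncard_coe_finset, card_piFinset_pair, Finset.card_range, Finset.card_range,
      show (4 : ℝ) ^ (n + 1) = 4 * (2 ^ n) ^ 2 by rw [pow_right_comm]; norm_num; ring]
    push_cast
    field_simp
    ring
  · refine tendsto_const_nhds.congr' ?_
    filter_upwards [eventually_ge_atTop 1] with e he
    obtain ⟨n, rfl⟩ := Nat.exists_eq_add_of_le' he
    rw [Ideal.frobPow_span_pair]
    have hset : Vnu
        ![Ideal.span {(MvPowerSeries.X 0 : MvPowerSeries (Fin 2) K)},
          Ideal.span {(MvPowerSeries.X 1 : MvPowerSeries (Fin 2) K) ^ 2 + MvPowerSeries.X 0}]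
        (Ideal.span {(MvPowerSeries.X 0 : MvPowerSeries (Fin 2) K) ^ 2 ^ (n + 1),
          MvPowerSeries.X 1 ^ 2 ^ (n + 1)}) =
        ↑(Fintype.piFinset ![Finset.range (2 ^ (n + 1)), Finset.range (2 ^ n)] ∪
          Fintype.piFinset ![Finset.range (2 ^ n), Finset.Ico (2 ^ n) (2 ^ (n + 1))]) := by
      ext a
      rw [mem_Vnu_span_pair, MvPowerSeries.X_pow_mul_sq_add_pow_notMem_iff, Finset.mem_coe,
        Finset.mem_union, mem_piFinset_pair, mem_piFinset_pair]
      simp only [Finset.mem_range, Finset.mem_Ico]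
    have hdisj : Disjoint
        (Fintype.piFinset ![Finset.range (2 ^ (n + 1)), Finset.range (2 ^ n)])
        (Fintype.piFinset ![Finset.range (2 ^ n), Finset.Ico (2 ^ n) (2 ^ (n + 1))]) := by
      refine Finset.disjoint_left.2 fun a h h' => ?_
      rw [mem_piFinset_pair, Finset.mem_range, Finset.mem_range] at h
      rw [mem_piFinset_pair, Finset.mem_Ico] at h'
      omega
    rw [hset, Set.ncard_coe_finset, Finset.card_union_of_disjoint hdisj, card_piFinset_pair,
      card_piFinset_pair, Finset.card_range, Finset.card_range, Nat.card_Ico,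
      show 2 ^ (n + 1) - 2 ^ n = 2 ^ n by rw [pow_succ]; omega,
      show (4 : ℝ) ^ (n + 1) = 4 * (2 ^ n) ^ 2 by rw [pow_right_comm]; norm_num; ring]
    push_cast
    field_simp
    ring
  · exact (Ideal.span_pair_add_left _ _).symm
end
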